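/- arXiv:2503.22439 — 2 statements merged into one kernel-verified Lean document; each statement's English description precedes it below -/
import Mathlib

section
/- Fix ε₂ ∈ (0, ε₃). There exists a constant C > 0, independent of the solution, of S, T, and of δ, such that every classical solution of system (S) satisfies, for every 0 ≤ S ≤ T and every δ > 0: ∫_S^T ∫_{1−ε₂}^{1} (u(t,x) − u_*)² dx dt ≤ C δ ∫_S^T E(t) dt + C (1/δ + 1) E(S). -/
open Set MeasureTheory

/-- A classical solution of system (S): a wave equation with localized in-domain damping and
Wentzell (dynamic) boundary conditions. -/
structure ClassicalSolutionS (a q : ℝ → ℝ) (α₁ α₂ β₁ γ₁ μ₁ : ℝ) where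
  u : ℝ → ℝ → ℝ
  ut : ℝ → ℝ → ℝ
  ux : ℝ → ℝ → ℝ
  utt : ℝ → ℝ → ℝ
  dAux : ℝ → ℝ → ℝ
  η₁ : ℝ → ℝ
  η₂ : ℝ → ℝ
  ζ₁ : ℝ → ℝ
  hu_t : ∀ t ∈ Ici (0:ℝ), ∀ x ∈ Icc (0:ℝ) 1, HasDerivAt (fun s => u s x) (ut t x) t
  hu_x : ∀ t ∈ Ici (0:ℝ), ∀ x ∈ Icc (0:ℝ) 1, HasDerivAt (fun y => u t y) (ux t x) x
  hut_C1 : ContDiffOn ℝ 1 (fun p : ℝ × ℝ => ut p.1 p.2) (Ici (0:ℝ) ×ˢ Icc (0:ℝ) 1)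
  hux_C1 : ContDiffOn ℝ 1 (fun p : ℝ × ℝ => ux p.1 p.2) (Ici (0:ℝ) ×ˢ Icc (0:ℝ) 1)
  hu_tt : ∀ t ∈ Ici (0:ℝ), ∀ x ∈ Icc (0:ℝ) 1, HasDerivAt (fun s => ut s x) (utt t x) t
  haux_lip : ∀ t ∈ Ici (0:ℝ),
      ∃ K : NNReal, LipschitzOnWith K (fun x => a x * ux t x) (Icc (0:ℝ) 1)
  haux : ∀ t ∈ Ici (0:ℝ), ∀ᵐ x ∂(volume.restrict (Ioo (0:ℝ) 1)),
      HasDerivAt (fun y => a y * ux t y) (dAux t x) x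
  hPDE : ∀ t ∈ Ici (0:ℝ), ∀ᵐ x ∂(volume.restrict (Ioo (0:ℝ) 1)),
      utt t x - dAux t x = - q x * ut t x
  hbc1 : ∀ t ∈ Ici (0:ℝ), ut t 1 = η₁ t
  hbc0 : ∀ t ∈ Ici (0:ℝ), ut t 0 = ζ₁ t
  hη₁C1 : ContDiffOn ℝ 1 η₁ (Ici (0:ℝ))
  hη₂C1 : ContDiffOn ℝ 1 η₂ (Ici (0:ℝ))
  hζ₁C1 : ContDiffOn ℝ 1 ζ₁ (Ici (0:ℝ))
  hode1 : ∀ t ∈ Ici (0:ℝ), HasDerivAt η₁ (-α₁ * η₁ t - α₂ * η₂ t - β₁ * ux t 1) t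
  hode2 : ∀ t ∈ Ici (0:ℝ), HasDerivAt η₂ (η₁ t) t
  hode3 : ∀ t ∈ Ici (0:ℝ), HasDerivAt ζ₁ (-γ₁ * ζ₁ t + μ₁ * ux t 0) t

/-- The energy of a classical solution of system (S). -/
noncomputable def energyS {a q : ℝ → ℝ} {α₁ α₂ β₁ γ₁ μ₁ : ℝ}
    (sol : ClassicalSolutionS a q α₁ α₂ β₁ γ₁ μ₁) (t : ℝ) : ℝ :=
  (1/2) * (∫ x in (0:ℝ)..1, (sol.ut t x ^ 2 + a x * sol.ux t x ^ 2))
    + (a 1 / (2 * β₁)) * sol.η₁ t ^ 2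
    + (a 1 * α₂ / (2 * β₁)) * sol.η₂ t ^ 2
    + (a 0 / (2 * μ₁)) * sol.ζ₁ t ^ 2

/-- Assumption (A1): `a` is Lipschitz on `[0,1]` and bounded below and above by positive
constants `a_min ≤ a_max`. -/
def AssumptionA1 (a : ℝ → ℝ) (a_min a_max : ℝ) : Prop :=
  (∃ K : NNReal, LipschitzOnWith K a (Icc (0:ℝ) 1)) ∧ 0 < a_min ∧ a_min ≤ a_max ∧
    ∀ x ∈ Icc (0:ℝ) 1, a_min ≤ a x ∧ a x ≤ a_max

/-- Assumption (A2'): `q` is bounded measurable, nonnegative a.e., and bounded below by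
`q_min > 0` a.e. on the interval `(1-ε₃, 1)`. -/
def AssumptionA2' (q : ℝ → ℝ) (ε₃ q_min : ℝ) : Prop :=
  Measurable q ∧ (∃ Q : ℝ, ∀ x ∈ Icc (0:ℝ) 1, |q x| ≤ Q) ∧
    (∀ᵐ x ∂(volume.restrict (Ioo (0:ℝ) 1)), 0 ≤ q x) ∧
    0 < ε₃ ∧ ε₃ < 1 ∧ 0 < q_min ∧
    ∀ᵐ x ∂(volume.restrict (Ioo (1 - ε₃) 1)), q_min ≤ q x

/-- The closed space-time strip `[0, ∞) × [0, 1]`. -/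
def strip : Set (ℝ × ℝ) := Ici (0:ℝ) ×ˢ Icc (0:ℝ) 1

/-- `f` is jointly continuous on the strip, with jointly continuous time derivative `f'`. -/
structure HasTimeDeriv (f f' : ℝ → ℝ → ℝ) : Prop where
  cont : ContinuousOn (fun p : ℝ × ℝ => f p.1 p.2) strip
  cont' : ContinuousOn (fun p : ℝ × ℝ => f' p.1 p.2) strip
  deriv : ∀ t ∈ Ici (0:ℝ), ∀ x ∈ Icc (0:ℝ) 1,
    HasDerivWithinAt (fun s => f s x) (f' t x) (Ici 0) t

section Strip

lemma exists_continuous_extension {f : ℝ → ℝ → ℝ}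
    (hf : ContinuousOn (fun p : ℝ × ℝ => f p.1 p.2) strip) :
    ∃ F : ℝ → ℝ → ℝ, Continuous (fun p : ℝ × ℝ => F p.1 p.2) ∧
      ∀ t ∈ Ici (0:ℝ), ∀ x ∈ Icc (0:ℝ) 1, F t x = f t x := by
  refine ⟨fun t x => f (max t 0) (max 0 (min x 1)), ?_, ?_⟩
  · have hc : Continuous (fun p : ℝ × ℝ => (max p.1 0, max 0 (min p.2 1))) := by fun_prop
    refine hf.comp_continuous hc fun p =>
      ⟨mem_Ici.2 (le_max_right _ _), le_max_left _ _, ?_⟩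
    exact max_le zero_le_one (min_le_right _ _)
  · intro t ht x hx
    simp only [mem_Ici, mem_Icc] at ht hx
    simp [ht, hx.1, hx.2]

lemma exists_continuous_extension_Icc {g : ℝ → ℝ} (hg : ContinuousOn g (Icc 0 1)) :
    ∃ G : ℝ → ℝ, Continuous G ∧ ∀ x ∈ Icc (0:ℝ) 1, G x = g x := by
  refine ⟨IccExtend zero_le_one (fun x : Icc (0:ℝ) 1 => g x), ?_, ?_⟩
  · exact (continuousOn_iff_continuous_domRestrict.1 hg).Icc_extend'
  · intro x hx
    exact IccExtend_of_mem _ _ hx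

lemma uIcc_subset_Icc_unit {y z : ℝ} (hy : y ∈ Icc (0:ℝ) 1) (hz : z ∈ Icc (0:ℝ) 1) :
    uIcc y z ⊆ Icc (0:ℝ) 1 :=
  ordConnected_Icc.uIcc_subset hy hz

lemma slice_continuousOn {f : ℝ → ℝ → ℝ}
    (hf : ContinuousOn (fun p : ℝ × ℝ => f p.1 p.2) strip) {t : ℝ} (ht : t ∈ Ici (0:ℝ)) :
    ContinuousOn (f t) (Icc 0 1) := by
  have hc : ContinuousOn (fun x : ℝ => (t, x)) (Icc 0 1) := by fun_prop
  exact hf.comp hc fun x hx => ⟨ht, hx⟩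

lemma continuousOn_primitive_strip {f : ℝ → ℝ → ℝ}
    (hf : ContinuousOn (fun p : ℝ × ℝ => f p.1 p.2) strip) :
    ContinuousOn (fun p : ℝ × ℝ => ∫ y in (0:ℝ)..p.2, f p.1 y) strip := by
  obtain ⟨F, hF, hFf⟩ := exists_continuous_extension hf
  have hc : Continuous (fun p : ℝ × ℝ => ∫ y in (0:ℝ)..p.2, F p.1 y) := by
    refine intervalIntegral.continuous_parametric_intervalIntegral_of_continuous
      (f := fun (p : ℝ × ℝ) y => F p.1 y) ?_ continuous_snd
    exact hF.comp (f := fun q : (ℝ × ℝ) × ℝ => (q.1.1, q.2)) (by fun_prop)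
  refine hc.continuousOn.congr fun p hp => ?_
  refine intervalIntegral.integral_congr fun y hy => ?_
  exact (hFf _ hp.1 _ (uIcc_subset_Icc_unit (by simp) hp.2 hy)).symm

lemma hasDerivWithinAt_primitive {g : ℝ → ℝ} (hg : ContinuousOn g (Icc 0 1)) {x : ℝ}
    (hx : x ∈ Icc (0:ℝ) 1) :
    HasDerivWithinAt (fun z => ∫ y in (0:ℝ)..z, g y) (g x) (Icc 0 1) x := by
  obtain ⟨G, hG, hGg⟩ := exists_continuous_extension_Icc hg
  have h : ∀ z ∈ Icc (0:ℝ) 1, ∫ y in (0:ℝ)..z, g y = ∫ y in (0:ℝ)..z, G y := fun z hz =>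
    intervalIntegral.integral_congr fun y hy =>
      (hGg y (uIcc_subset_Icc_unit (by simp) hz hy)).symm
  rw [← hGg x hx]
  exact (hG.integral_hasStrictDerivAt 0 x).hasDerivAt.hasDerivWithinAt.congr h (h x hx)

lemma intervalIntegrable_of_continuousOn_unit {g : ℝ → ℝ} (hg : ContinuousOn g (Icc 0 1))
    {y z : ℝ} (hy : y ∈ Icc (0:ℝ) 1) (hz : z ∈ Icc (0:ℝ) 1) :
    IntervalIntegrable g volume y z :=
  (hg.mono (uIcc_subset_Icc_unit hy hz)).intervalIntegrable

lemma integral_eq_sub_unit {g g' : ℝ → ℝ} (hg' : ContinuousOn g' (Icc 0 1))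
    (hd : ∀ x ∈ Icc (0:ℝ) 1, HasDerivWithinAt g (g' x) (Icc 0 1) x) {y z : ℝ}
    (hy : y ∈ Icc (0:ℝ) 1) (hz : z ∈ Icc (0:ℝ) 1) :
    ∫ x in y..z, g' x = g z - g y := by
  have hsub := uIcc_subset_Icc_unit hy hz
  refine intervalIntegral.integral_eq_sub_of_hasDeriv_right
    (fun x hx => ((hd x (hsub hx)).continuousWithinAt).mono hsub) (fun x hx => ?_)
    (intervalIntegrable_of_continuousOn_unit hg' hy hz)
  have h0 : (0:ℝ) < x := lt_of_le_of_lt (le_min hy.1 hz.1) hx.1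
  have h1 : x < 1 := lt_of_lt_of_le hx.2 (max_le hy.2 hz.2)
  exact ((hd x ⟨h0.le, h1.le⟩).hasDerivAt (Icc_mem_nhds h0 h1)).hasDerivWithinAt

/-- Integration by parts of a `C¹` function against a Lipschitz function. -/
lemma integral_mul_deriv_of_lipschitz {φ ψ g g' : ℝ → ℝ} {K : NNReal}
    (hψ : ContinuousOn ψ (Icc 0 1))
    (hφ : ∀ x ∈ Icc (0:ℝ) 1, HasDerivWithinAt φ (ψ x) (Icc 0 1) x)
    (hg : LipschitzOnWith K g (Icc 0 1))
    (hgd : ∀ᵐ x ∂(volume.restrict (Ioo (0:ℝ) 1)), HasDerivAt g (g' x) x) :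
    IntervalIntegrable g' volume 0 1 ∧
    ∫ x in (0:ℝ)..1, φ x * g' x = φ 1 * g 1 - φ 0 * g 0 - ∫ x in (0:ℝ)..1, ψ x * g x := by
  have hu : uIcc (0:ℝ) 1 = Icc 0 1 := uIcc_of_le zero_le_one
  obtain ⟨C, hC⟩ := isCompact_Icc.exists_bound_of_continuousOn hψ
  have hφL : LipschitzOnWith C.toNNReal φ (Icc 0 1) := by
    refine (convex_Icc (0:ℝ) 1).lipschitzOnWith_of_nnnorm_hasDerivWithin_le hφ fun x hx => ?_
    rw [← NNReal.coe_le_coe, coe_nnnorm]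
    exact (hC x hx).trans (Real.le_coe_toNNReal C)
  have hga : AbsolutelyContinuousOnInterval g 0 1 :=
    LipschitzOnWith.absolutelyContinuousOnInterval (hu ▸ hg)
  have hφa : AbsolutelyContinuousOnInterval φ 0 1 :=
    LipschitzOnWith.absolutelyContinuousOnInterval (hu ▸ hφL)
  have hrestr : volume.restrict (uIoc (0:ℝ) 1) = volume.restrict (Ioo (0:ℝ) 1) := by
    rw [uIoc_of_le zero_le_one]
    exact (Measure.restrict_congr_set Ioo_ae_eq_Ioc).symm
  have hg'd : ∀ᵐ x ∂(volume.restrict (uIoc (0:ℝ) 1)), deriv g x = g' x := by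
    rw [hrestr]
    filter_upwards [hgd] with x hx using hx.deriv
  have hφd : ∀ᵐ x ∂(volume.restrict (uIoc (0:ℝ) 1)), deriv φ x = ψ x := by
    rw [hrestr]
    filter_upwards [ae_restrict_mem measurableSet_Ioo] with x hx
    exact ((hφ x ⟨hx.1.le, hx.2.le⟩).hasDerivAt (Icc_mem_nhds hx.1 hx.2)).deriv
  refine ⟨hga.intervalIntegrable_deriv.congr_ae hg'd, ?_⟩
  have hmain := hφa.integral_mul_deriv_eq_deriv_mul hga
  have e1 : ∫ x in (0:ℝ)..1, φ x * deriv g x = ∫ x in (0:ℝ)..1, φ x * g' x := by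
    refine intervalIntegral.integral_congr_ae_restrict ?_
    filter_upwards [hg'd] with x hx
    rw [hx]
  have e2 : ∫ x in (0:ℝ)..1, deriv φ x * g x = ∫ x in (0:ℝ)..1, ψ x * g x := by
    refine intervalIntegral.integral_congr_ae_restrict ?_
    filter_upwards [hφd] with x hx
    rw [hx]
  rw [← e1, hmain, e2]

end Strip

namespace HasTimeDeriv

variable {f f' g g' : ℝ → ℝ → ℝ}

lemma of_contDiffOn (hf : ContDiffOn ℝ 1 (fun p : ℝ × ℝ => f p.1 p.2) strip) :
    HasTimeDeriv f
      (fun t x => fderivWithin ℝ (fun p : ℝ × ℝ => f p.1 p.2) strip (t, x) (1, 0)) := by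
  have hun : UniqueDiffOn ℝ strip :=
    (uniqueDiffOn_Ici 0).prod (uniqueDiffOn_Icc zero_lt_one)
  refine ⟨hf.continuousOn, ?_, fun t ht x hx => ?_⟩
  · exact (hf.continuousOn_fderivWithin hun le_rfl).clm_apply continuousOn_const
  · have h1 : HasFDerivWithinAt (fun p : ℝ × ℝ => f p.1 p.2)
        (fderivWithin ℝ (fun p : ℝ × ℝ => f p.1 p.2) strip (t, x)) strip (t, x) :=
      (hf.differentiableOn one_ne_zero (t, x) ⟨ht, hx⟩).hasFDerivWithinAt
    have h2 : HasDerivWithinAt (fun s : ℝ => (s, x)) ((1:ℝ), (0:ℝ)) (Ici 0) t :=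
      (hasDerivWithinAt_id t _).prodMk (hasDerivWithinAt_const t _ x)
    exact h1.comp_hasDerivWithinAt t h2 fun s hs => mem_prod.2 ⟨hs, hx⟩

lemma congr_deriv {f'' : ℝ → ℝ → ℝ} (hf : HasTimeDeriv f f')
    (h : ∀ t ∈ Ici (0:ℝ), ∀ x ∈ Icc (0:ℝ) 1, f'' t x = f' t x) : HasTimeDeriv f f'' :=
  ⟨hf.cont, hf.cont'.congr fun _ hp => h _ hp.1 _ hp.2,
    fun t ht x hx => h t ht x hx ▸ hf.deriv t ht x hx⟩

lemma add (hf : HasTimeDeriv f f') (hg : HasTimeDeriv g g') :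
    HasTimeDeriv (fun t x => f t x + g t x) (fun t x => f' t x + g' t x) :=
  ⟨hf.cont.add hg.cont, hf.cont'.add hg.cont',
    fun t ht x hx => (hf.deriv t ht x hx).add (hg.deriv t ht x hx)⟩

lemma mul (hf : HasTimeDeriv f f') (hg : HasTimeDeriv g g') :
    HasTimeDeriv (fun t x => f t x * g t x) (fun t x => f' t x * g t x + f t x * g' t x) :=
  ⟨hf.cont.mul hg.cont, (hf.cont'.mul hg.cont).add (hf.cont.mul hg.cont'),
    fun t ht x hx => (hf.deriv t ht x hx).mul (hg.deriv t ht x hx)⟩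

lemma weight_mul {φ : ℝ → ℝ} (hφ : ContinuousOn φ (Icc 0 1)) (hf : HasTimeDeriv f f') :
    HasTimeDeriv (fun t x => φ x * f t x) (fun t x => φ x * f' t x) := by
  have hc : ContinuousOn (fun p : ℝ × ℝ => φ p.2) strip :=
    hφ.comp continuousOn_snd fun _ hp => hp.2
  exact ⟨hc.mul hf.cont, hc.mul hf.cont',
    fun t ht x hx => (hf.deriv t ht x hx).const_mul (φ x)⟩

lemma slice (hf : HasTimeDeriv f f') {y : ℝ} (hy : y ∈ Icc (0:ℝ) 1) :
    HasTimeDeriv (fun t _ => f t y) (fun t _ => f' t y) := by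
  have hc : ContinuousOn (fun p : ℝ × ℝ => (p.1, y)) strip := by fun_prop
  exact ⟨hf.cont.comp hc fun _ hp => ⟨hp.1, hy⟩, hf.cont'.comp hc fun _ hp => ⟨hp.1, hy⟩,
    fun t ht _ _ => hf.deriv t ht y hy⟩

/-- Differentiation under the integral sign. -/
lemma hasDerivWithinAt_integral (hf : HasTimeDeriv f f') {y z : ℝ} (hy : y ∈ Icc (0:ℝ) 1)
    (hz : z ∈ Icc (0:ℝ) 1) {t : ℝ} (ht : t ∈ Ici (0:ℝ)) :
    HasDerivWithinAt (fun s => ∫ x in y..z, f s x) (∫ x in y..z, f' t x) (Ici 0) t := by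
  obtain ⟨F, hF, hFf⟩ := exists_continuous_extension hf.cont'
  have hsub := uIcc_subset_Icc_unit hy hz
  have hG : Continuous (fun s => ∫ x in y..z, F s x) :=
    intervalIntegral.continuous_parametric_intervalIntegral_of_continuous'
      (f := F) hF y z
  have key : ∀ s ∈ Ici (0:ℝ), ∫ x in y..z, f s x =
      (∫ x in y..z, f 0 x) + ∫ r in (0:ℝ)..s, ∫ x in y..z, F r x := by
    intro s hs
    have hswap : ∫ r in (0:ℝ)..s, ∫ x in y..z, F r x =
        ∫ x in y..z, ∫ r in (0:ℝ)..s, F r x := by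
      refine intervalIntegral_intervalIntegral_swap ?_
      refine (hF.continuousOn.integrableOn_compact
        (isCompact_uIcc.prod isCompact_uIcc)).mono_set
        (prod_mono uIoc_subset_uIcc uIoc_subset_uIcc)
    rw [hswap, ← sub_eq_iff_eq_add', ← intervalIntegral.integral_sub
      (intervalIntegrable_of_continuousOn_unit (slice_continuousOn hf.cont hs) hy hz)
      (intervalIntegrable_of_continuousOn_unit
        (slice_continuousOn hf.cont self_mem_Ici) hy hz)]
    refine intervalIntegral.integral_congr fun x hx => ?_
    have hx' := hsub hx
    have hFx : Continuous (fun r => F r x) := hF.comp (f := fun r => (r, x)) (by fun_prop)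
    refine (intervalIntegral.integral_eq_sub_of_hasDeriv_right (f := fun r => f r x)
      (fun r hr => ?_) (fun r hr => ?_) (hFx.intervalIntegrable _ _)).symm
    · rw [uIcc_of_le hs] at hr
      exact (hf.deriv r hr.1 x hx').continuousWithinAt.mono
        (by rw [uIcc_of_le hs]; exact Icc_subset_Ici_self)
    · rw [min_eq_left hs] at hr
      rw [hFf r hr.1.le x hx']
      exact (hf.deriv r hr.1.le x hx').mono
        (Ioi_subset_Ici_self.trans (Ici_subset_Ici.2 hr.1.le))
  have hval : ∫ x in y..z, f' t x = ∫ x in y..z, F t x :=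
    intervalIntegral.integral_congr fun x hx => (hFf t ht x (hsub hx)).symm
  rw [hval]
  exact ((hG.integral_hasStrictDerivAt 0 t).hasDerivAt.const_add _).hasDerivWithinAt.congr
    key (key t ht)

lemma primitive (hf : HasTimeDeriv f f') :
    HasTimeDeriv (fun t x => ∫ y in (0:ℝ)..x, f t y) (fun t x => ∫ y in (0:ℝ)..x, f' t y) :=
  ⟨continuousOn_primitive_strip hf.cont, continuousOn_primitive_strip hf.cont',
    fun _ ht _ hx => hf.hasDerivWithinAt_integral (by simp) hx ht⟩

end HasTimeDeriv

namespace ClassicalSolutionS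

variable {a q : ℝ → ℝ} {α₁ α₂ β₁ γ₁ μ₁ : ℝ} (sol : ClassicalSolutionS a q α₁ α₂ β₁ γ₁ μ₁)

lemma hasTimeDeriv_ut : HasTimeDeriv sol.ut sol.utt :=
  (HasTimeDeriv.of_contDiffOn sol.hut_C1).congr_deriv fun t ht x hx =>
    (uniqueDiffWithinAt_Ici t |>.mono (Ici_subset_Ici.2 ht)).eq_deriv _
      (sol.hu_tt t ht x hx).hasDerivWithinAt
      ((HasTimeDeriv.of_contDiffOn sol.hut_C1).deriv t ht x hx)

/-- The mixed second derivative of a classical solution. -/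
noncomputable def uxt (t x : ℝ) : ℝ :=
  fderivWithin ℝ (fun p : ℝ × ℝ => sol.ux p.1 p.2) strip (t, x) (1, 0)

lemma hasTimeDeriv_ux : HasTimeDeriv sol.ux sol.uxt :=
  HasTimeDeriv.of_contDiffOn sol.hux_C1

lemma integral_ux {t : ℝ} (ht : t ∈ Ici (0:ℝ)) {y z : ℝ} (hy : y ∈ Icc (0:ℝ) 1)
    (hz : z ∈ Icc (0:ℝ) 1) : ∫ x in y..z, sol.ux t x = sol.u t z - sol.u t y :=
  integral_eq_sub_unit (slice_continuousOn sol.hasTimeDeriv_ux.cont ht)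
    (fun x hx => (sol.hu_x t ht x hx).hasDerivWithinAt) hy hz

lemma hasTimeDeriv_u : HasTimeDeriv sol.u sol.ut := by
  refine ⟨?_, sol.hasTimeDeriv_ut.cont, fun t ht x hx => (sol.hu_t t ht x hx).hasDerivWithinAt⟩
  have h0 : ContinuousOn (fun t => sol.u t 0) (Ici 0) := fun t ht =>
    (sol.hu_t t ht 0 (by simp)).continuousAt.continuousWithinAt
  refine ((h0.comp continuousOn_fst fun (p : ℝ × ℝ) (hp : p ∈ strip) => hp.1).add
    (continuousOn_primitive_strip sol.hasTimeDeriv_ux.cont)).congr fun p hp => ?_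
  simp [sol.integral_ux hp.1 (y := 0) (by simp) hp.2]

lemma integral_uxt {t : ℝ} (ht : t ∈ Ici (0:ℝ)) {z : ℝ} (hz : z ∈ Icc (0:ℝ) 1) :
    ∫ x in (0:ℝ)..z, sol.uxt t x = sol.ut t z - sol.ut t 0 := by
  have h0 : (0:ℝ) ∈ Icc (0:ℝ) 1 := by simp
  have h1 := sol.hasTimeDeriv_ux.hasDerivWithinAt_integral h0 hz ht
  have h2 : HasDerivWithinAt (fun s => ∫ x in (0:ℝ)..z, sol.ux s x)
      (sol.ut t z - sol.ut t 0) (Ici 0) t :=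
    ((sol.hu_t t ht z hz).sub (sol.hu_t t ht 0 h0)).hasDerivWithinAt.congr
      (fun s hs => sol.integral_ux hs h0 hz) (sol.integral_ux ht h0 hz)
  exact (uniqueDiffWithinAt_Ici t |>.mono (Ici_subset_Ici.2 ht)).eq_deriv _ h1 h2

lemma ut_hasDerivWithinAt_space {t x : ℝ} (ht : t ∈ Ici (0:ℝ)) (hx : x ∈ Icc (0:ℝ) 1) :
    HasDerivWithinAt (sol.ut t) (sol.uxt t x) (Icc 0 1) x := by
  have h := hasDerivWithinAt_primitive (slice_continuousOn sol.hasTimeDeriv_ux.cont' ht) hx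
  refine (h.add_const (sol.ut t 0)).congr (fun z hz => ?_) ?_
  · rw [sol.integral_uxt ht hz]; ring
  · rw [sol.integral_uxt ht hx]; ring

/-- The displacement relative to the conserved quantity `u(0,1) - η₂(0)`. -/
noncomputable def shifted (t x : ℝ) : ℝ := sol.u t x - (sol.u 0 1 - sol.η₂ 0)

lemma hasTimeDeriv_shifted : HasTimeDeriv sol.shifted sol.ut :=
  ⟨sol.hasTimeDeriv_u.cont.sub continuousOn_const, sol.hasTimeDeriv_ut.cont,
    fun t ht x hx => (sol.hasTimeDeriv_u.deriv t ht x hx).sub_const _⟩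

lemma shifted_hasDerivWithinAt_space {t x : ℝ} (ht : t ∈ Ici (0:ℝ)) (hx : x ∈ Icc (0:ℝ) 1) :
    HasDerivWithinAt (sol.shifted t) (sol.ux t x) (Icc 0 1) x :=
  ((sol.hu_x t ht x hx).sub_const _).hasDerivWithinAt

lemma shifted_one {t : ℝ} (ht : t ∈ Ici (0:ℝ)) : sol.shifted t 1 = sol.η₂ t := by
  have hd : ∀ s ∈ Ici (0:ℝ), HasDerivWithinAt (fun s => sol.u s 1 - sol.η₂ s) 0 (Ici 0) s := by
    intro s hs
    have := (sol.hu_t s hs 1 (by simp)).sub (sol.hode2 s hs)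
    rw [sol.hbc1 s hs, sub_self] at this
    exact this.hasDerivWithinAt
  have hc : (fun s => sol.u s 1 - sol.η₂ s) t = (fun s => sol.u s 1 - sol.η₂ s) 0 := by
    refine (convex_Ici (0:ℝ)).is_const_of_fderivWithin_eq_zero (𝕜 := ℝ)
      (fun s hs => (hd s hs).differentiableWithinAt) (fun s hs => ?_) ht self_mem_Ici
    ext
    simpa [fderivWithin_derivWithin] using (hd s hs).derivWithin (uniqueDiffOn_Ici 0 s hs)
  simp only at hc
  unfold shifted
  linarith

lemma weak_form (hq : IntervalIntegrable q volume 0 1) {φ ψ : ℝ → ℝ}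
    (hψ : ContinuousOn ψ (Icc 0 1))
    (hφ : ∀ x ∈ Icc (0:ℝ) 1, HasDerivWithinAt φ (ψ x) (Icc 0 1) x) {t : ℝ}
    (ht : t ∈ Ici (0:ℝ)) :
    ∫ x in (0:ℝ)..1, φ x * sol.utt t x =
      φ 1 * (a 1 * sol.ux t 1) - φ 0 * (a 0 * sol.ux t 0)
        - (∫ x in (0:ℝ)..1, ψ x * (a x * sol.ux t x))
        - ∫ x in (0:ℝ)..1, q x * (φ x * sol.ut t x) := by
  have hφc : ContinuousOn φ (Icc 0 1) := fun x hx => (hφ x hx).continuousWithinAt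
  have hutc := slice_continuousOn sol.hasTimeDeriv_ut.cont ht
  obtain ⟨K, hK⟩ := sol.haux_lip t ht
  obtain ⟨hint, hparts⟩ := integral_mul_deriv_of_lipschitz hψ hφ hK (sol.haux t ht)
  have hu : uIcc (0:ℝ) 1 = Icc 0 1 := uIcc_of_le zero_le_one
  rw [← hparts, ← intervalIntegral.integral_sub (hint.continuousOn_mul (hu ▸ hφc))
    (hq.mul_continuousOn (hu ▸ hφc.mul hutc))]
  refine intervalIntegral.integral_congr_ae_restrict ?_
  rw [uIoc_of_le zero_le_one, Measure.restrict_congr_set Ioo_ae_eq_Ioc.symm]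
  filter_upwards [sol.hPDE t ht] with x hx
  rw [show sol.utt t x = sol.dAux t x - q x * sol.ut t x by linarith]
  ring

/-- The rate of energy dissipation. -/
noncomputable def dissipation (t : ℝ) : ℝ :=
  (∫ x in (0:ℝ)..1, q x * sol.ut t x ^ 2) + a 1 * α₁ / β₁ * sol.η₁ t ^ 2
    + a 0 * γ₁ / μ₁ * sol.ζ₁ t ^ 2

lemma hasDerivWithinAt_energy (ha : ContinuousOn a (Icc 0 1))
    (hq : IntervalIntegrable q volume 0 1) (hβ₁ : β₁ ≠ 0) (hμ₁ : μ₁ ≠ 0) {t : ℝ}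
    (ht : t ∈ Ici (0:ℝ)) :
    HasDerivWithinAt (energyS sol) (-sol.dissipation t) (Ici 0) t := by
  have h0 : (0:ℝ) ∈ Icc (0:ℝ) 1 := by simp
  have h1 : (1:ℝ) ∈ Icc (0:ℝ) 1 := by simp
  have hdens : HasTimeDeriv (fun t x => sol.ut t x ^ 2 + a x * sol.ux t x ^ 2)
      (fun t x => 2 * (sol.ut t x * sol.utt t x + sol.uxt t x * (a x * sol.ux t x))) := by
    convert! (sol.hasTimeDeriv_ut.mul sol.hasTimeDeriv_ut).add
      ((sol.hasTimeDeriv_ux.mul sol.hasTimeDeriv_ux).weight_mul ha) using 3 <;> ring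
  have hI := (hdens.hasDerivWithinAt_integral h0 h1 ht).const_mul (1/2 : ℝ)
  have hη₁ := (((sol.hode1 t ht).pow 2).const_mul (a 1 / (2 * β₁))).hasDerivWithinAt (s := Ici 0)
  have hη₂ := (((sol.hode2 t ht).pow 2).const_mul
    (a 1 * α₂ / (2 * β₁))).hasDerivWithinAt (s := Ici 0)
  have hζ₁ := (((sol.hode3 t ht).pow 2).const_mul (a 0 / (2 * μ₁))).hasDerivWithinAt (s := Ici 0)
  convert! ((hI.add hη₁).add hη₂).add hζ₁ using 1
  have hutc := slice_continuousOn sol.hasTimeDeriv_ut.cont ht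
  have huxc := slice_continuousOn sol.hasTimeDeriv_ux.cont ht
  have huxtc := slice_continuousOn sol.hasTimeDeriv_ux.cont' ht
  have huttc := slice_continuousOn sol.hasTimeDeriv_ut.cont' ht
  have hw := sol.weak_form hq huxtc (fun x hx => sol.ut_hasDerivWithinAt_space ht hx) ht
  have hi₁ : IntervalIntegrable (fun x => sol.ut t x * sol.utt t x) volume 0 1 :=
    intervalIntegrable_of_continuousOn_unit (hutc.mul huttc) h0 h1
  have hi₂ : IntervalIntegrable (fun x => sol.uxt t x * (a x * sol.ux t x)) volume 0 1 :=
    intervalIntegrable_of_continuousOn_unit (huxtc.mul (ha.mul huxc)) h0 h1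
  rw [intervalIntegral.integral_const_mul, intervalIntegral.integral_add hi₁ hi₂, hw]
  rw [sol.hbc1 t ht, sol.hbc0 t ht]
  simp only [dissipation, pow_two]
  field_simp
  ring

end ClassicalSolutionS

section Potential

/-- The weighted primitive `∫₀ˣ w f`. -/
noncomputable def mass (w : ℝ → ℝ) (f : ℝ → ℝ → ℝ) (t x : ℝ) : ℝ :=
  ∫ y in (0:ℝ)..x, w y * f t y

/-- The solution `v` of `(a vₓ)ₓ = w f` with `vₓ(0) = 0` and `v(1) = -k ∫₀¹ w f`. -/
noncomputable def potential (a w : ℝ → ℝ) (k : ℝ) (f : ℝ → ℝ → ℝ) (t x : ℝ) : ℝ :=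
  -k * mass w f t 1 + ((-1) * (∫ y in (0:ℝ)..1, (a y)⁻¹ * mass w f t y)
    + ∫ y in (0:ℝ)..x, (a y)⁻¹ * mass w f t y)

variable {a w : ℝ → ℝ} {k : ℝ} {f f' : ℝ → ℝ → ℝ}

lemma potential_one (t : ℝ) : potential a w k f t 1 = -k * mass w f t 1 := by
  unfold potential; ring

lemma HasTimeDeriv.mass (hw : ContinuousOn w (Icc 0 1)) (hf : HasTimeDeriv f f') :
    HasTimeDeriv (mass w f) (_root_.mass w f') :=
  (hf.weight_mul hw).primitive

lemma HasTimeDeriv.potential (ha : ContinuousOn (fun x => (a x)⁻¹) (Icc 0 1))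
    (hw : ContinuousOn w (Icc 0 1)) (hf : HasTimeDeriv f f') :
    HasTimeDeriv (potential a w k f) (_root_.potential a w k f') := by
  have h1 : (1:ℝ) ∈ Icc (0:ℝ) 1 := by simp
  have hm := hf.mass hw
  have hH := (hm.weight_mul ha).primitive
  exact ((hm.slice h1).weight_mul (φ := fun _ => -k) continuousOn_const).add
    (((hH.slice h1).weight_mul (φ := fun _ => -1) continuousOn_const).add hH)

lemma continuousOn_mass (hw : ContinuousOn w (Icc 0 1)) {t : ℝ}
    (hf : ContinuousOn (f t) (Icc 0 1)) : ContinuousOn (mass w f t) (Icc 0 1) := fun _ hx =>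
  (hasDerivWithinAt_primitive (hw.mul hf) hx).continuousWithinAt

lemma potential_hasDerivWithinAt_space (ha : ContinuousOn (fun x => (a x)⁻¹) (Icc 0 1))
    (hw : ContinuousOn w (Icc 0 1)) {t x : ℝ} (hf : ContinuousOn (f t) (Icc 0 1))
    (hx : x ∈ Icc (0:ℝ) 1) :
    HasDerivWithinAt (potential a w k f t) ((a x)⁻¹ * mass w f t x) (Icc 0 1) x :=
  ((hasDerivWithinAt_primitive (ha.mul (continuousOn_mass hw hf)) hx).const_add _).const_add _

lemma sq_integral_abs_le {h : ℝ → ℝ} (hh : ContinuousOn h (Icc 0 1)) :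
    (∫ x in (0:ℝ)..1, |h x|) ^ 2 ≤ ∫ x in (0:ℝ)..1, h x ^ 2 := by
  have h0 : (0:ℝ) ∈ Icc (0:ℝ) 1 := by simp
  have h1 : (1:ℝ) ∈ Icc (0:ℝ) 1 := by simp
  set m := ∫ x in (0:ℝ)..1, |h x| with hm
  have hi₁ : IntervalIntegrable (fun x => h x ^ 2) volume 0 1 :=
    intervalIntegrable_of_continuousOn_unit (hh.pow 2) h0 h1
  have hi₂ : IntervalIntegrable (fun x => 2 * m * |h x|) volume 0 1 :=
    intervalIntegrable_of_continuousOn_unit (continuousOn_const.mul hh.abs) h0 h1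
  have hnn : 0 ≤ ∫ x in (0:ℝ)..1, (h x ^ 2 - 2 * m * |h x| + m ^ 2) :=
    intervalIntegral.integral_nonneg zero_le_one fun x _ => by
      nlinarith [sq_nonneg (|h x| - m), sq_abs (h x)]
  rw [intervalIntegral.integral_add (hi₁.sub hi₂) intervalIntegrable_const,
    intervalIntegral.integral_sub hi₁ hi₂, intervalIntegral.integral_const_mul, ← hm,
    intervalIntegral.integral_const] at hnn
  simp only [sub_zero, smul_eq_mul, one_mul] at hnn
  nlinarith

lemma sq_potential_le {a_min : ℝ} (hmin : 0 < a_min) (ha : ∀ x ∈ Icc (0:ℝ) 1, a_min ≤ a x)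
    (hw : ContinuousOn w (Icc 0 1)) (hac : ContinuousOn (fun x => (a x)⁻¹) (Icc 0 1))
    (hk : 0 ≤ k) {t x : ℝ} (hf : ContinuousOn (f t) (Icc 0 1)) (hx : x ∈ Icc (0:ℝ) 1) :
    potential a w k f t x ^ 2 ≤
      (k + a_min⁻¹) ^ 2 * ∫ y in (0:ℝ)..1, (w y * f t y) ^ 2 := by
  have h0 : (0:ℝ) ∈ Icc (0:ℝ) 1 := by simp
  have h1 : (1:ℝ) ∈ Icc (0:ℝ) 1 := by simp
  have hc : ContinuousOn (fun y => w y * f t y) (Icc 0 1) := hw.mul hf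
  set m := ∫ y in (0:ℝ)..1, |w y * f t y| with hm
  have hm0 : 0 ≤ m := intervalIntegral.integral_nonneg zero_le_one fun _ _ => abs_nonneg _
  have hmass : ∀ z ∈ Icc (0:ℝ) 1, |mass w f t z| ≤ m := by
    intro z hz
    refine (intervalIntegral.abs_integral_le_integral_abs hz.1).trans ?_
    exact intervalIntegral.integral_mono_interval le_rfl hz.1 hz.2
      (Filter.Eventually.of_forall fun _ => abs_nonneg _)
      (intervalIntegrable_of_continuousOn_unit hc.abs h0 h1)
  have hHc : ContinuousOn (fun y => (a y)⁻¹ * mass w f t y) (Icc 0 1) :=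
    hac.mul (continuousOn_mass hw hf)
  have hH : |∫ y in x..1, (a y)⁻¹ * mass w f t y| ≤ a_min⁻¹ * m := by
    have hb : ∀ y ∈ uIoc x 1, ‖(a y)⁻¹ * mass w f t y‖ ≤ a_min⁻¹ * m := by
      intro y hy
      have hy' := uIcc_subset_Icc_unit hx h1 (uIoc_subset_uIcc hy)
      have hay := ha y hy'
      rw [Real.norm_eq_abs, abs_mul, abs_inv, abs_of_pos (hmin.trans_le hay)]
      exact mul_le_mul (inv_anti₀ hmin hay) (hmass y hy') (abs_nonneg _)
        (inv_nonneg.2 hmin.le)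
    refine (intervalIntegral.norm_integral_le_of_norm_le_const hb).trans ?_
    rw [abs_of_nonneg (sub_nonneg.2 hx.2)]
    exact mul_le_of_le_one_right (by positivity) (by linarith [hx.1])
  have hsplit := intervalIntegral.integral_add_adjacent_intervals
    (intervalIntegrable_of_continuousOn_unit hHc h0 hx)
    (intervalIntegrable_of_continuousOn_unit hHc hx h1)
  have hval : potential a w k f t x =
      -(k * mass w f t 1) - ∫ y in x..1, (a y)⁻¹ * mass w f t y := by
    unfold potential
    linarith
  have habs : |potential a w k f t x| ≤ (k + a_min⁻¹) * m := by
    rw [hval]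
    refine (abs_sub _ _).trans ?_
    rw [abs_neg, abs_mul, abs_of_nonneg hk, add_mul]
    exact add_le_add (mul_le_mul_of_nonneg_left (hmass 1 h1) hk) hH
  calc potential a w k f t x ^ 2 ≤ ((k + a_min⁻¹) * m) ^ 2 := sq_le_sq' (by
        linarith [neg_abs_le (potential a w k f t x)]) ((le_abs_self _).trans habs)
    _ = (k + a_min⁻¹) ^ 2 * m ^ 2 := by ring
    _ ≤ _ := mul_le_mul_of_nonneg_left (sq_integral_abs_le hc) (sq_nonneg _)

end Potential

namespace ClassicalSolutionS

variable {a q w : ℝ → ℝ} {α₁ α₂ β₁ γ₁ μ₁ : ℝ}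
  (sol : ClassicalSolutionS a q α₁ α₂ β₁ γ₁ μ₁)

/-- The functional obtained by pairing the solution with the potential of its displacement. -/
noncomputable def multiplier (w : ℝ → ℝ) (k t : ℝ) : ℝ :=
  (∫ x in (0:ℝ)..1, potential a w k sol.shifted t x * sol.ut t x)
    + a 0 / μ₁ * (potential a w k sol.shifted t 0 * sol.ζ₁ t)
    + a 1 / β₁ * (potential a w k sol.shifted t 1 * sol.η₁ t)

/-- The difference between the derivative of the multiplier and the weighted `L²` norm. -/
noncomputable def remainder (w : ℝ → ℝ) (k t : ℝ) : ℝ :=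
  (∫ x in (0:ℝ)..1, potential a w k sol.ut t x * sol.ut t x)
    + a 0 / μ₁ * (potential a w k sol.ut t 0 * sol.ζ₁ t)
    + a 1 / β₁ * (potential a w k sol.ut t 1 * sol.η₁ t)
    - (∫ x in (0:ℝ)..1, q x * (potential a w k sol.shifted t x * sol.ut t x))
    - a 0 * γ₁ / μ₁ * (potential a w k sol.shifted t 0 * sol.ζ₁ t)
    - a 1 * α₁ / β₁ * (potential a w k sol.shifted t 1 * sol.η₁ t)

lemma hasDerivWithinAt_multiplier (ha : ∀ x ∈ Icc (0:ℝ) 1, a x ≠ 0)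
    (hac : ContinuousOn a (Icc 0 1)) (hw : ContinuousOn w (Icc 0 1))
    (hq : IntervalIntegrable q volume 0 1) (hα₂ : α₂ ≠ 0) (hβ₁ : β₁ ≠ 0) (hμ₁ : μ₁ ≠ 0) {t : ℝ}
    (ht : t ∈ Ici (0:ℝ)) :
    HasDerivWithinAt (sol.multiplier w (β₁ / (a 1 * α₂)))
      ((∫ x in (0:ℝ)..1, w x * sol.shifted t x ^ 2) + sol.remainder w (β₁ / (a 1 * α₂)) t)
      (Ici 0) t := by
  have h0 : (0:ℝ) ∈ Icc (0:ℝ) 1 := by simp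
  have h1 : (1:ℝ) ∈ Icc (0:ℝ) 1 := by simp
  have hainv : ContinuousOn (fun x => (a x)⁻¹) (Icc 0 1) := hac.inv₀ ha
  set k := β₁ / (a 1 * α₂) with hk
  have hv : HasTimeDeriv (potential a w k sol.shifted) (potential a w k sol.ut) :=
    sol.hasTimeDeriv_shifted.potential hainv hw
  have hfc := slice_continuousOn sol.hasTimeDeriv_shifted.cont ht
  have hutc := slice_continuousOn sol.hasTimeDeriv_ut.cont ht
  have huxc := slice_continuousOn sol.hasTimeDeriv_ux.cont ht
  have huttc := slice_continuousOn sol.hasTimeDeriv_ut.cont' ht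
  have hvc := slice_continuousOn hv.cont ht
  have hvtc := slice_continuousOn hv.cont' ht
  have hmc := continuousOn_mass hw hfc
  have hweak := sol.weak_form (ψ := fun x => (a x)⁻¹ * mass w sol.shifted t x) hq (hainv.mul hmc)
    (fun x hx => potential_hasDerivWithinAt_space (k := k) hainv hw hfc hx) ht
  have hflux : ∫ x in (0:ℝ)..1, (a x)⁻¹ * mass w sol.shifted t x * (a x * sol.ux t x) =
      mass w sol.shifted t 1 * sol.η₂ t - ∫ x in (0:ℝ)..1, w x * sol.shifted t x ^ 2 := by
    have hu : uIcc (0:ℝ) 1 = Icc 0 1 := uIcc_of_le zero_le_one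
    have hpart := intervalIntegral.integral_mul_deriv_eq_deriv_mul_of_hasDerivWithinAt
      (a := 0) (b := 1) (u := mass w sol.shifted t) (v := sol.shifted t)
      (u' := fun x => w x * sol.shifted t x) (v' := sol.ux t)
      (fun x hx => by
        rw [hu] at hx ⊢
        exact hasDerivWithinAt_primitive (hw.mul hfc) hx)
      (fun x hx => by
        rw [hu] at hx ⊢
        exact sol.shifted_hasDerivWithinAt_space ht hx)
      (intervalIntegrable_of_continuousOn_unit (hw.mul hfc) h0 h1)
      (intervalIntegrable_of_continuousOn_unit huxc h0 h1)
    have hmass0 : mass w sol.shifted t 0 = 0 := by simp [mass]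
    rw [sol.shifted_one ht, hmass0, zero_mul, sub_zero] at hpart
    calc ∫ x in (0:ℝ)..1, (a x)⁻¹ * mass w sol.shifted t x * (a x * sol.ux t x)
        = ∫ x in (0:ℝ)..1, mass w sol.shifted t x * sol.ux t x := by
          refine intervalIntegral.integral_congr fun x hx => ?_
          have := ha x (hu ▸ hx)
          field_simp
      _ = _ := by
          rw [hpart]
          congr 1
          refine intervalIntegral.integral_congr fun x _ => ?_
          ring
  have hI := (hv.mul sol.hasTimeDeriv_ut).hasDerivWithinAt_integral h0 h1 ht
  have hζ := (((hv.deriv t ht 0 h0).mul (sol.hode3 t ht).hasDerivWithinAt).const_mul (a 0 / μ₁))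
  have hη := (((hv.deriv t ht 1 h1).mul (sol.hode1 t ht).hasDerivWithinAt).const_mul (a 1 / β₁))
  convert! (hI.add hζ).add hη using 1
  have hi₁ : IntervalIntegrable (fun x => potential a w k sol.ut t x * sol.ut t x) volume 0 1 :=
    intervalIntegrable_of_continuousOn_unit (hvtc.mul hutc) h0 h1
  have hi₂ : IntervalIntegrable
      (fun x => potential a w k sol.shifted t x * sol.utt t x) volume 0 1 :=
    intervalIntegrable_of_continuousOn_unit (hvc.mul huttc) h0 h1
  have ha1 : a 1 ≠ 0 := ha 1 h1
  have hone : mass w sol.shifted t 1 * sol.η₂ t =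
      -(a 1 * α₂ / β₁ * (potential a w k sol.shifted t 1 * sol.η₂ t)) := by
    rw [potential_one, hk]
    field_simp
  rw [intervalIntegral.integral_add hi₁ hi₂, hweak, hflux, hone, remainder]
  field_simp
  ring

end ClassicalSolutionS

namespace ClassicalSolutionS

variable {a q w : ℝ → ℝ} {a_min a_max ε₃ q_min α₁ α₂ β₁ γ₁ μ₁ : ℝ}

lemma le_one_div_mul_of_mul_le {c y e : ℝ} (hc : 0 < c) (h : c * y ≤ e) : y ≤ 1 / c * e := by
  rwa [one_div, inv_mul_eq_div, le_div_iff₀ hc, mul_comm]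

lemma energy_bounds (hA1 : AssumptionA1 a a_min a_max) (hα₂ : 0 < α₂) (hβ₁ : 0 < β₁)
    (hμ₁ : 0 < μ₁) (sol : ClassicalSolutionS a q α₁ α₂ β₁ γ₁ μ₁) {t : ℝ} (ht : t ∈ Ici (0:ℝ)) :
    0 ≤ energyS sol t ∧ (∫ x in (0:ℝ)..1, sol.ut t x ^ 2) ≤ 2 * energyS sol t ∧
    (∫ x in (0:ℝ)..1, sol.ux t x ^ 2) ≤ 2 / a_min * energyS sol t ∧
    sol.η₁ t ^ 2 ≤ 2 * β₁ / a 1 * energyS sol t ∧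
    sol.η₂ t ^ 2 ≤ 2 * β₁ / (a 1 * α₂) * energyS sol t ∧
    sol.ζ₁ t ^ 2 ≤ 2 * μ₁ / a 0 * energyS sol t := by
  obtain ⟨⟨L, hL⟩, hmin, -, hab⟩ := hA1
  have h0 : (0:ℝ) ∈ Icc (0:ℝ) 1 := by simp
  have h1 : (1:ℝ) ∈ Icc (0:ℝ) 1 := by simp
  have ha0 : 0 < a 0 := hmin.trans_le (hab 0 h0).1
  have ha1 : 0 < a 1 := hmin.trans_le (hab 1 h1).1
  have hutc := slice_continuousOn sol.hasTimeDeriv_ut.cont ht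
  have huxc := slice_continuousOn sol.hasTimeDeriv_ux.cont ht
  have hi₁ : IntervalIntegrable (fun x => sol.ut t x ^ 2) volume 0 1 :=
    intervalIntegrable_of_continuousOn_unit (hutc.pow 2) h0 h1
  have hi₂ : IntervalIntegrable (fun x => a x * sol.ux t x ^ 2) volume 0 1 :=
    intervalIntegrable_of_continuousOn_unit (hL.continuousOn.mul (huxc.pow 2)) h0 h1
  have hi₃ : IntervalIntegrable (fun x => a_min * sol.ux t x ^ 2) volume 0 1 :=
    intervalIntegrable_of_continuousOn_unit (continuousOn_const.mul (huxc.pow 2)) h0 h1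
  have hX := intervalIntegral.integral_mono_on zero_le_one hi₃ hi₂ fun x hx =>
    mul_le_mul_of_nonneg_right (hab x hx).1 (sq_nonneg (sol.ux t x))
  rw [intervalIntegral.integral_const_mul] at hX
  have hE : energyS sol t = (1/2) * ((∫ x in (0:ℝ)..1, sol.ut t x ^ 2)
      + ∫ x in (0:ℝ)..1, a x * sol.ux t x ^ 2) + (a 1 / (2 * β₁)) * sol.η₁ t ^ 2
      + (a 1 * α₂ / (2 * β₁)) * sol.η₂ t ^ 2 + (a 0 / (2 * μ₁)) * sol.ζ₁ t ^ 2 := by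
    rw [← intervalIntegral.integral_add hi₁ hi₂, energyS]
  have hT0 : 0 ≤ ∫ x in (0:ℝ)..1, sol.ut t x ^ 2 :=
    intervalIntegral.integral_nonneg zero_le_one fun _ _ => sq_nonneg _
  have hX0 : 0 ≤ a_min * ∫ x in (0:ℝ)..1, sol.ux t x ^ 2 := mul_nonneg hmin.le <|
    intervalIntegral.integral_nonneg zero_le_one fun _ _ => sq_nonneg _
  have n1 : 0 ≤ (a 1 / (2 * β₁)) * sol.η₁ t ^ 2 := by positivity
  have n2 : 0 ≤ (a 1 * α₂ / (2 * β₁)) * sol.η₂ t ^ 2 := by positivity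
  have n3 : 0 ≤ (a 0 / (2 * μ₁)) * sol.ζ₁ t ^ 2 := by positivity
  refine ⟨by linarith, by linarith, ?_, ?_, ?_, ?_⟩
  · convert! le_one_div_mul_of_mul_le (c := a_min / 2) (y := ∫ x in (0:ℝ)..1, sol.ux t x ^ 2)
      (e := energyS sol t) (by positivity) (by linarith) using 2
    field_simp
  · convert! le_one_div_mul_of_mul_le (c := a 1 / (2 * β₁)) (y := sol.η₁ t ^ 2)
      (e := energyS sol t) (by positivity) (by linarith) using 2
    field_simp
  · convert! le_one_div_mul_of_mul_le (c := a 1 * α₂ / (2 * β₁)) (y := sol.η₂ t ^ 2)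
      (e := energyS sol t) (by positivity) (by linarith) using 2
    field_simp
  · convert! le_one_div_mul_of_mul_le (c := a 0 / (2 * μ₁)) (y := sol.ζ₁ t ^ 2)
      (e := energyS sol t) (by positivity) (by linarith) using 2
    field_simp

lemma sq_shifted_le (hA1 : AssumptionA1 a a_min a_max) (hα₂ : 0 < α₂) (hβ₁ : 0 < β₁)
    (hμ₁ : 0 < μ₁) (sol : ClassicalSolutionS a q α₁ α₂ β₁ γ₁ μ₁) {t x : ℝ}
    (ht : t ∈ Ici (0:ℝ)) (hx : x ∈ Icc (0:ℝ) 1) :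
    sol.shifted t x ^ 2 ≤ (4 * β₁ / (a 1 * α₂) + 4 / a_min) * energyS sol t := by
  have h0 : (0:ℝ) ∈ Icc (0:ℝ) 1 := by simp
  have h1 : (1:ℝ) ∈ Icc (0:ℝ) 1 := by simp
  obtain ⟨-, -, hux, -, hη₂, -⟩ := sol.energy_bounds hA1 hα₂ hβ₁ hμ₁ ht
  have huxc := slice_continuousOn sol.hasTimeDeriv_ux.cont ht
  have hdiff : sol.η₂ t - sol.shifted t x = ∫ y in x..1, sol.ux t y := by
    rw [sol.integral_ux ht hx h1, ← sol.shifted_one ht]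
    unfold shifted
    ring
  have habs : |∫ y in x..1, sol.ux t y| ≤ ∫ y in (0:ℝ)..1, |sol.ux t y| :=
    (intervalIntegral.abs_integral_le_integral_abs hx.2).trans <|
      intervalIntegral.integral_mono_interval hx.1 hx.2 le_rfl
        (Filter.Eventually.of_forall fun _ => abs_nonneg _)
        (intervalIntegrable_of_continuousOn_unit huxc.abs h0 h1)
  have hsq : (∫ y in x..1, sol.ux t y) ^ 2 ≤ 2 / a_min * energyS sol t :=
    ((sq_le_sq.2 (habs.trans (le_abs_self _))).trans (sq_integral_abs_le huxc)).trans hux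
  rw [← hdiff] at hsq
  have hsum : sol.shifted t x ^ 2 ≤
      2 * sol.η₂ t ^ 2 + 2 * (sol.η₂ t - sol.shifted t x) ^ 2 := by
    nlinarith [sq_nonneg (sol.η₂ t + (sol.η₂ t - sol.shifted t x))]
  calc sol.shifted t x ^ 2 ≤ 2 * (2 * β₁ / (a 1 * α₂) * energyS sol t) +
        2 * (2 / a_min * energyS sol t) := by linarith
    _ = _ := by ring

lemma intervalIntegrable_damping (hA2 : AssumptionA2' q ε₃ q_min) :
    IntervalIntegrable q volume 0 1 := by
  obtain ⟨hqm, ⟨Q, hQ⟩, -⟩ := hA2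
  rw [intervalIntegrable_iff]
  refine Measure.integrableOn_of_bounded (M := Q) (by simp) hqm.aestronglyMeasurable ?_
  filter_upwards [ae_restrict_mem measurableSet_uIoc] with x hx
  exact hQ x (uIcc_subset_Icc_unit (by simp) (by simp) (uIoc_subset_uIcc hx))

lemma dissipation_bounds (hA1 : AssumptionA1 a a_min a_max) (hA2 : AssumptionA2' q ε₃ q_min)
    (hα₁ : 0 < α₁) (hβ₁ : 0 < β₁) (hγ₁ : 0 < γ₁) (hμ₁ : 0 < μ₁)
    (hw : ContinuousOn w (Icc 0 1)) (hw01 : ∀ x, 0 ≤ w x ∧ w x ≤ 1)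
    (hw0 : ∀ x ≤ 1 - ε₃, w x = 0)
    (sol : ClassicalSolutionS a q α₁ α₂ β₁ γ₁ μ₁) {t : ℝ} (ht : t ∈ Ici (0:ℝ)) :
    0 ≤ sol.dissipation t ∧
    (∫ x in (0:ℝ)..1, q x * sol.ut t x ^ 2) ≤ sol.dissipation t ∧
    (∫ x in (0:ℝ)..1, (w x * sol.ut t x) ^ 2) ≤ 1 / q_min * sol.dissipation t ∧
    sol.η₁ t ^ 2 ≤ β₁ / (a 1 * α₁) * sol.dissipation t ∧
    sol.ζ₁ t ^ 2 ≤ μ₁ / (a 0 * γ₁) * sol.dissipation t := by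
  have hqi := intervalIntegrable_damping hA2
  obtain ⟨-, hmin, -, hab⟩ := hA1
  obtain ⟨-, -, hq0, -, -, hqmin, hqw⟩ := hA2
  have h0 : (0:ℝ) ∈ Icc (0:ℝ) 1 := by simp
  have h1 : (1:ℝ) ∈ Icc (0:ℝ) 1 := by simp
  have ha0 : 0 < a 0 := hmin.trans_le (hab 0 h0).1
  have ha1 : 0 < a 1 := hmin.trans_le (hab 1 h1).1
  have hu : uIcc (0:ℝ) 1 = Icc 0 1 := uIcc_of_le zero_le_one
  have hutc := slice_continuousOn sol.hasTimeDeriv_ut.cont ht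
  have hi : IntervalIntegrable (fun x => q x * sol.ut t x ^ 2) volume 0 1 :=
    hqi.mul_continuousOn (hu ▸ hutc.pow 2)
  have hiw : IntervalIntegrable (fun x => q_min * (w x * sol.ut t x) ^ 2) volume 0 1 :=
    intervalIntegrable_of_continuousOn_unit (continuousOn_const.mul ((hw.mul hutc).pow 2)) h0 h1
  have hpt : ∀ᵐ x ∂(volume.restrict (Ioo (0:ℝ) 1)),
      q_min * (w x * sol.ut t x) ^ 2 ≤ q x * sol.ut t x ^ 2 := by
    rw [ae_restrict_iff' measurableSet_Ioo] at hqw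
    filter_upwards [hq0, ae_restrict_of_ae hqw, ae_restrict_mem measurableSet_Ioo]
      with x hx0 hxw hx
    rcases le_or_gt x (1 - ε₃) with h | h
    · rw [hw0 x h]
      have := mul_nonneg hx0 (sq_nonneg (sol.ut t x))
      simpa using this
    · have hw1 : w x ^ 2 ≤ 1 := pow_le_one₀ (hw01 x).1 (hw01 x).2
      have hle : (w x * sol.ut t x) ^ 2 ≤ sol.ut t x ^ 2 := by
        rw [mul_pow]
        exact mul_le_of_le_one_left (sq_nonneg _) hw1
      exact (mul_le_mul_of_nonneg_left hle hqmin.le).trans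
        (mul_le_mul_of_nonneg_right (hxw ⟨h, hx.2⟩) (sq_nonneg _))
  rw [Measure.restrict_congr_set Ioo_ae_eq_Icc] at hpt
  have hcmp := intervalIntegral.integral_mono_ae_restrict zero_le_one hiw hi hpt
  rw [intervalIntegral.integral_const_mul] at hcmp
  have hW0 : 0 ≤ q_min * ∫ x in (0:ℝ)..1, (w x * sol.ut t x) ^ 2 := mul_nonneg hqmin.le <|
    intervalIntegral.integral_nonneg zero_le_one fun _ _ => sq_nonneg _
  have n1 : 0 ≤ a 1 * α₁ / β₁ * sol.η₁ t ^ 2 := by positivity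
  have n2 : 0 ≤ a 0 * γ₁ / μ₁ * sol.ζ₁ t ^ 2 := by positivity
  have hD : sol.dissipation t = (∫ x in (0:ℝ)..1, q x * sol.ut t x ^ 2)
      + a 1 * α₁ / β₁ * sol.η₁ t ^ 2 + a 0 * γ₁ / μ₁ * sol.ζ₁ t ^ 2 := rfl
  refine ⟨by linarith, by linarith, le_one_div_mul_of_mul_le hqmin (by linarith), ?_, ?_⟩
  · convert! le_one_div_mul_of_mul_le (c := a 1 * α₁ / β₁) (y := sol.η₁ t ^ 2)
      (e := sol.dissipation t) (by positivity) (by linarith) using 2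
    field_simp
  · convert! le_one_div_mul_of_mul_le (c := a 0 * γ₁ / μ₁) (y := sol.ζ₁ t ^ 2)
      (e := sol.dissipation t) (by positivity) (by linarith) using 2
    field_simp

/-- All quadratic quantities are controlled, with a uniform constant, by the energy or by
the dissipation. -/
lemma exists_uniform_bounds (hA1 : AssumptionA1 a a_min a_max)
    (hA2 : AssumptionA2' q ε₃ q_min)
    (hα₁ : 0 < α₁) (hα₂ : 0 < α₂) (hβ₁ : 0 < β₁) (hγ₁ : 0 < γ₁) (hμ₁ : 0 < μ₁)
    (hw : ContinuousOn w (Icc 0 1)) (hw01 : ∀ x, 0 ≤ w x ∧ w x ≤ 1)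
    (hw0 : ∀ x ≤ 1 - ε₃, w x = 0) {k : ℝ} (hk : 0 ≤ k) :
    ∃ C > (0:ℝ), ∀ sol : ClassicalSolutionS a q α₁ α₂ β₁ γ₁ μ₁, ∀ t ∈ Ici (0:ℝ),
      (∫ x in (0:ℝ)..1, sol.ut t x ^ 2) ≤ C * energyS sol t ∧
      sol.η₁ t ^ 2 ≤ C * energyS sol t ∧ sol.ζ₁ t ^ 2 ≤ C * energyS sol t ∧
      sol.η₁ t ^ 2 ≤ C * sol.dissipation t ∧ sol.ζ₁ t ^ 2 ≤ C * sol.dissipation t ∧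
      (∀ x ∈ Icc (0:ℝ) 1, potential a w k sol.shifted t x ^ 2 ≤ C * energyS sol t) ∧
      (∀ x ∈ Icc (0:ℝ) 1, potential a w k sol.ut t x ^ 2 ≤ C * sol.dissipation t) := by
  have hmin := hA1.2.1
  have hqmin : 0 < q_min := hA2.2.2.2.2.2.1
  have h0 : (0:ℝ) ∈ Icc (0:ℝ) 1 := by simp
  have h1 : (1:ℝ) ∈ Icc (0:ℝ) 1 := by simp
  have ha : ∀ x ∈ Icc (0:ℝ) 1, a_min ≤ a x := fun x hx => (hA1.2.2.2 x hx).1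
  have ha0 : 0 < a 0 := hmin.trans_le (ha 0 h0)
  have ha1 : 0 < a 1 := hmin.trans_le (ha 1 h1)
  have hac : ContinuousOn (fun x => (a x)⁻¹) (Icc 0 1) := by
    obtain ⟨⟨L, hL⟩, -⟩ := hA1
    exact hL.continuousOn.inv₀ fun x hx => (hmin.trans_le (ha x hx)).ne'
  set c₁ := 2 * β₁ / a 1
  set c₂ := 2 * μ₁ / a 0
  set c₃ := β₁ / (a 1 * α₁)
  set c₄ := μ₁ / (a 0 * γ₁)
  set c₅ := 4 * β₁ / (a 1 * α₂) + 4 / a_min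
  set K := (k + a_min⁻¹) ^ 2
  have p₁ : 0 ≤ c₁ := by positivity
  have p₂ : 0 ≤ c₂ := by positivity
  have p₃ : 0 ≤ c₃ := by positivity
  have p₄ : 0 ≤ c₄ := by positivity
  have p₅ : 0 ≤ K * c₅ := by positivity
  have p₆ : 0 ≤ K * (1 / q_min) := by positivity
  refine ⟨2 + c₁ + c₂ + c₃ + c₄ + K * c₅ + K * (1 / q_min), by positivity, fun sol t ht => ?_⟩
  obtain ⟨he, hut, -, hη, -, hζ⟩ := sol.energy_bounds hA1 hα₂ hβ₁ hμ₁ ht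
  obtain ⟨hd, -, hwut, hη', hζ'⟩ :=
    sol.dissipation_bounds hA1 hA2 hα₁ hβ₁ hγ₁ hμ₁ hw hw01 hw0 ht
  have hutc := slice_continuousOn sol.hasTimeDeriv_ut.cont ht
  have hfc := slice_continuousOn sol.hasTimeDeriv_shifted.cont ht
  have hwf : ∫ x in (0:ℝ)..1, (w x * sol.shifted t x) ^ 2 ≤ c₅ * energyS sol t := by
    have hb := intervalIntegral.integral_mono_on zero_le_one
      (intervalIntegrable_of_continuousOn_unit ((hw.mul hfc).pow 2) h0 h1)
      (intervalIntegrable_const (c := c₅ * energyS sol t)) (fun x hx => by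
        change (w x * sol.shifted t x) ^ 2 ≤ _
        rw [mul_pow]
        exact (mul_le_of_le_one_left (sq_nonneg _) (pow_le_one₀ (hw01 x).1 (hw01 x).2)).trans
          (sol.sq_shifted_le hA1 hα₂ hβ₁ hμ₁ ht hx))
    simpa using hb
  have hv : ∀ x ∈ Icc (0:ℝ) 1,
      potential a w k sol.shifted t x ^ 2 ≤ K * c₅ * energyS sol t := fun x hx =>
    (sq_potential_le hmin ha hw hac hk hfc hx).trans <| by
      rw [mul_assoc]; exact mul_le_mul_of_nonneg_left hwf (sq_nonneg _)
  have hvt : ∀ x ∈ Icc (0:ℝ) 1,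
      potential a w k sol.ut t x ^ 2 ≤ K * (1 / q_min) * sol.dissipation t := fun x hx =>
    (sq_potential_le hmin ha hw hac hk hutc hx).trans <| by
      rw [mul_assoc]; exact mul_le_mul_of_nonneg_left hwut (sq_nonneg _)
  refine ⟨hut.trans ?_, hη.trans ?_, hζ.trans ?_, hη'.trans ?_, hζ'.trans ?_,
    fun x hx => (hv x hx).trans ?_, fun x hx => (hvt x hx).trans ?_⟩ <;>
  refine mul_le_mul_of_nonneg_right ?_ (by assumption) <;> linarith

end ClassicalSolutionS

section Young

lemma abs_mul_le_young {δ : ℝ} (hδ : 0 < δ) (x y : ℝ) :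
    |x * y| ≤ δ * x ^ 2 + 1 / δ * y ^ 2 := by
  have h : 0 ≤ 1 / δ * (δ * |x| - |y|) ^ 2 := by positivity
  have e : 1 / δ * (δ * |x| - |y|) ^ 2 = δ * x ^ 2 - 2 * (|x| * |y|) + 1 / δ * y ^ 2 := by
    rw [← sq_abs x, ← sq_abs y]
    field_simp
    ring
  rw [abs_mul]
  nlinarith [mul_nonneg (abs_nonneg x) (abs_nonneg y)]

lemma abs_integral_mul_mul_le {q f g : ℝ → ℝ} {Q c : ℝ} (hq : IntervalIntegrable q volume 0 1)
    (hq0 : ∀ᵐ x ∂(volume.restrict (Ioo (0:ℝ) 1)), 0 ≤ q x) (hQ : ∀ x ∈ Icc (0:ℝ) 1, |q x| ≤ Q)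
    (hf : ContinuousOn f (Icc 0 1)) (hg : ContinuousOn g (Icc 0 1))
    (hc : ∫ x in (0:ℝ)..1, f x ^ 2 ≤ c) {δ : ℝ} (hδ : 0 < δ) :
    |∫ x in (0:ℝ)..1, q x * (f x * g x)| ≤
      δ * (Q * c) + 1 / δ * ∫ x in (0:ℝ)..1, q x * g x ^ 2 := by
  have h0 : (0:ℝ) ∈ Icc (0:ℝ) 1 := by simp
  have h1 : (1:ℝ) ∈ Icc (0:ℝ) 1 := by simp
  have hu : uIcc (0:ℝ) 1 = Icc 0 1 := uIcc_of_le zero_le_one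
  have hQ0 : 0 ≤ Q := (abs_nonneg _).trans (hQ 0 h0)
  have hi₁ : IntervalIntegrable (fun x => δ * Q * f x ^ 2) volume 0 1 :=
    intervalIntegrable_of_continuousOn_unit (continuousOn_const.mul (hf.pow 2)) h0 h1
  have hi₂ : IntervalIntegrable (fun x => 1 / δ * (q x * g x ^ 2)) volume 0 1 :=
    (hq.mul_continuousOn (hu ▸ hg.pow 2)).const_mul _
  have hpt : ∀ᵐ x, x ∈ Ioc (0:ℝ) 1 →
      ‖q x * (f x * g x)‖ ≤ δ * Q * f x ^ 2 + 1 / δ * (q x * g x ^ 2) := by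
    rw [Measure.restrict_congr_set Ioo_ae_eq_Ioc, ae_restrict_iff' measurableSet_Ioc] at hq0
    filter_upwards [hq0] with x hx0 hx
    have hqx := hx0 hx
    have hqQ : q x ≤ Q := (le_abs_self _).trans (hQ x (Ioc_subset_Icc_self hx))
    rw [Real.norm_eq_abs, abs_mul, abs_of_nonneg hqx]
    calc q x * |f x * g x| ≤ q x * (δ * f x ^ 2 + 1 / δ * g x ^ 2) :=
          mul_le_mul_of_nonneg_left (abs_mul_le_young hδ _ _) hqx
      _ = q x * (δ * f x ^ 2) + 1 / δ * (q x * g x ^ 2) := by ring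
      _ ≤ Q * (δ * f x ^ 2) + 1 / δ * (q x * g x ^ 2) := by gcongr
      _ = _ := by ring
  have hb := intervalIntegral.norm_integral_le_of_norm_le zero_le_one hpt (hi₁.add hi₂)
  rw [intervalIntegral.integral_add hi₁ hi₂, intervalIntegral.integral_const_mul,
    intervalIntegral.integral_const_mul, mul_assoc] at hb
  refine hb.trans (add_le_add_left ?_ _)
  gcongr

lemma abs_integral_mul_le {f g : ℝ → ℝ} (hf : ContinuousOn f (Icc 0 1))
    (hg : ContinuousOn g (Icc 0 1)) {c c' : ℝ} (hc : ∫ x in (0:ℝ)..1, f x ^ 2 ≤ c)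
    (hc' : ∫ x in (0:ℝ)..1, g x ^ 2 ≤ c') {δ : ℝ} (hδ : 0 < δ) :
    |∫ x in (0:ℝ)..1, f x * g x| ≤ δ * c + 1 / δ * c' := by
  have h := abs_integral_mul_mul_le (q := fun _ => 1) (Q := 1) intervalIntegrable_const
    (Filter.Eventually.of_forall fun _ => zero_le_one) (fun _ _ => by simp) hf hg hc hδ
  simp only [one_mul] at h
  refine h.trans (add_le_add_right ?_ _)
  gcongr

lemma integral_sq_le_of_sq_le {f : ℝ → ℝ} (hf : ContinuousOn f (Icc 0 1)) {c : ℝ}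
    (h : ∀ x ∈ Icc (0:ℝ) 1, f x ^ 2 ≤ c) : ∫ x in (0:ℝ)..1, f x ^ 2 ≤ c := by
  simpa using intervalIntegral.integral_mono_on zero_le_one
    (intervalIntegrable_of_continuousOn_unit (hf.pow 2) (by simp) (by simp))
    (intervalIntegrable_const (c := c)) h

end Young

namespace ClassicalSolutionS

variable {a q w : ℝ → ℝ} {a_min a_max ε₂ ε₃ q_min α₁ α₂ β₁ γ₁ μ₁ : ℝ}

lemma exists_multiplier_bounds (hA1 : AssumptionA1 a a_min a_max)
    (hA2 : AssumptionA2' q ε₃ q_min)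
    (hα₁ : 0 < α₁) (hα₂ : 0 < α₂) (hβ₁ : 0 < β₁) (hγ₁ : 0 < γ₁) (hμ₁ : 0 < μ₁)
    (hw : ContinuousOn w (Icc 0 1)) (hw01 : ∀ x, 0 ≤ w x ∧ w x ≤ 1)
    (hw0 : ∀ x ≤ 1 - ε₃, w x = 0) {k : ℝ} (hk : 0 ≤ k) :
    ∃ C > (0:ℝ), ∀ sol : ClassicalSolutionS a q α₁ α₂ β₁ γ₁ μ₁, ∀ t ∈ Ici (0:ℝ),
      |sol.multiplier w k t| ≤ C * energyS sol t ∧ ∀ δ > (0:ℝ),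
      -sol.remainder w k t ≤
        C * δ * energyS sol t + C * (1 / δ + 1) * sol.dissipation t := by
  obtain ⟨C, hC, hbd⟩ :=
    exists_uniform_bounds hA1 hA2 hα₁ hα₂ hβ₁ hγ₁ hμ₁ hw hw01 hw0 hk
  have hqi := intervalIntegrable_damping hA2
  obtain ⟨Q, hQ⟩ := hA2.2.1
  have hq0 := hA2.2.2.1
  have hmin := hA1.2.1
  have h0 : (0:ℝ) ∈ Icc (0:ℝ) 1 := by simp
  have h1 : (1:ℝ) ∈ Icc (0:ℝ) 1 := by simp
  have hQ0 : 0 ≤ Q := (abs_nonneg _).trans (hQ 0 h0)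
  have ha : ∀ x ∈ Icc (0:ℝ) 1, 0 < a x := fun x hx => hmin.trans_le (hA1.2.2.2 x hx).1
  have ha0 := ha 0 h0
  have ha1 := ha 1 h1
  have hac : ContinuousOn (fun x => (a x)⁻¹) (Icc 0 1) := by
    obtain ⟨⟨L, hL⟩, -⟩ := hA1
    exact hL.continuousOn.inv₀ fun x hx => (ha x hx).ne'
  set A := a 0 / μ₁ with hA
  set B := a 1 / β₁ with hB
  have hA0 : 0 < A := by positivity
  have hB0 : 0 < B := by positivity
  refine ⟨C * (2 + Q + A * γ₁ + B * α₁ + 2 * A + 2 * B) + 1, by positivity,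
    fun sol t ht => ?_⟩
  obtain ⟨hut, hη, hζ, hη', hζ', hv, hvt⟩ := hbd sol t ht
  obtain ⟨he, -⟩ := sol.energy_bounds hA1 hα₂ hβ₁ hμ₁ ht
  obtain ⟨hd, hqut, -⟩ := sol.dissipation_bounds hA1 hA2 hα₁ hβ₁ hγ₁ hμ₁ hw hw01 hw0 ht
  have hpot : HasTimeDeriv (potential a w k sol.shifted) (potential a w k sol.ut) :=
    sol.hasTimeDeriv_shifted.potential hac hw
  have hutc := slice_continuousOn sol.hasTimeDeriv_ut.cont ht
  have hvc := slice_continuousOn hpot.cont ht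
  have hvtc := slice_continuousOn hpot.cont' ht
  have iv := integral_sq_le_of_sq_le hvc hv
  have ivt := integral_sq_le_of_sq_le hvtc hvt
  set e := energyS sol t
  set d := sol.dissipation t
  constructor
  · have m₁ := abs_integral_mul_le hvc hutc iv hut one_pos
    have m₂ := mul_le_mul_of_nonneg_left
      (abs_mul_le_young one_pos (potential a w k sol.shifted t 0) (sol.ζ₁ t)) hA0.le
    have m₃ := mul_le_mul_of_nonneg_left
      (abs_mul_le_young one_pos (potential a w k sol.shifted t 1) (sol.η₁ t)) hB0.le
    have n₂ := mul_le_mul_of_nonneg_left (add_le_add (hv 0 h0) hζ) hA0.le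
    have n₃ := mul_le_mul_of_nonneg_left (add_le_add (hv 1 h1) hη) hB0.le
    have hsum : |sol.multiplier w k t| ≤
        |∫ x in (0:ℝ)..1, potential a w k sol.shifted t x * sol.ut t x|
          + A * |potential a w k sol.shifted t 0 * sol.ζ₁ t|
          + B * |potential a w k sol.shifted t 1 * sol.η₁ t| := by
      unfold multiplier
      refine (abs_add_le _ _).trans (add_le_add ((abs_add_le _ _).trans (add_le_add le_rfl ?_)) ?_)
      · rw [abs_mul, abs_of_pos hA0]
      · rw [abs_mul, abs_of_pos hB0]
    have hrest : 0 ≤ C * (Q + A * γ₁ + B * α₁) * e + e := by positivity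
    linarith
  · intro δ hδ
    have m₁ := abs_integral_mul_le hutc hvtc hut ivt hδ
    have m₂ := mul_le_mul_of_nonneg_left
      (abs_mul_le_young one_pos (potential a w k sol.ut t 0) (sol.ζ₁ t)) hA0.le
    have m₃ := mul_le_mul_of_nonneg_left
      (abs_mul_le_young one_pos (potential a w k sol.ut t 1) (sol.η₁ t)) hB0.le
    have n₂ := mul_le_mul_of_nonneg_left (add_le_add (hvt 0 h0) hζ') hA0.le
    have n₃ := mul_le_mul_of_nonneg_left (add_le_add (hvt 1 h1) hη') hB0.le
    have m₄ := abs_integral_mul_mul_le hqi hq0 hQ hvc hutc iv hδ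
    have hδ' : 0 ≤ 1 / δ := by positivity
    have n₄ := mul_le_mul_of_nonneg_left hqut hδ'
    have hyoung : ∀ {x y : ℝ}, x ^ 2 ≤ C * e → y ^ 2 ≤ C * d →
        x * y ≥ -(δ * (C * e) + 1 / δ * (C * d)) ∧ x * y ≤ δ * (C * e) + 1 / δ * (C * d) := by
      intro x y hx hy
      refine abs_le.1 ((abs_mul_le_young hδ x y).trans ?_)
      gcongr
    have m₅ := mul_le_mul_of_nonneg_left (hyoung (hv 0 h0) hζ').2 (mul_pos hA0 hγ₁).le
    have m₆ := mul_le_mul_of_nonneg_left (hyoung (hv 1 h1) hη').2 (mul_pos hB0 hα₁).le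
    have k₁ := neg_le_abs (∫ x in (0:ℝ)..1, sol.ut t x * potential a w k sol.ut t x)
    have k₂ := mul_le_mul_of_nonneg_left
      (neg_le_abs (potential a w k sol.ut t 0 * sol.ζ₁ t)) hA0.le
    have k₃ := mul_le_mul_of_nonneg_left
      (neg_le_abs (potential a w k sol.ut t 1 * sol.η₁ t)) hB0.le
    have k₄ := le_abs_self
      (∫ x in (0:ℝ)..1, q x * (potential a w k sol.shifted t x * sol.ut t x))
    have hrem : sol.remainder w k t =
        (∫ x in (0:ℝ)..1, sol.ut t x * potential a w k sol.ut t x)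
          + A * (potential a w k sol.ut t 0 * sol.ζ₁ t)
          + B * (potential a w k sol.ut t 1 * sol.η₁ t)
          - (∫ x in (0:ℝ)..1, q x * (potential a w k sol.shifted t x * sol.ut t x))
          - A * γ₁ * (potential a w k sol.shifted t 0 * sol.ζ₁ t)
          - B * α₁ * (potential a w k sol.shifted t 1 * sol.η₁ t) := by
      simp only [remainder, mul_comm (sol.ut t _), hA, hB]
      ring
    have r₁ : 0 ≤ (C * (1 + 2 * A + 2 * B) + 1) * (δ * e) := by positivity
    have r₂ : 0 ≤ C * (1 + Q + 2 * A + 2 * B) * (1 / δ * d) := by positivity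
    have r₃ : 0 ≤ (C * (2 + Q + A * γ₁ + B * α₁) + 1) * d := by positivity
    linarith

lemma energy_antitoneOn (hA1 : AssumptionA1 a a_min a_max) (hA2 : AssumptionA2' q ε₃ q_min)
    (hα₁ : 0 < α₁) (hβ₁ : 0 < β₁) (hγ₁ : 0 < γ₁) (hμ₁ : 0 < μ₁)
    (sol : ClassicalSolutionS a q α₁ α₂ β₁ γ₁ μ₁) : AntitoneOn (energyS sol) (Ici 0) := by
  have hderiv : ∀ t ∈ Ici (0:ℝ),
      HasDerivWithinAt (energyS sol) (-sol.dissipation t) (Ici 0) t := fun t ht => by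
    obtain ⟨⟨L, hL⟩, -⟩ := hA1
    exact sol.hasDerivWithinAt_energy hL.continuousOn (intervalIntegrable_damping hA2)
      hβ₁.ne' hμ₁.ne' ht
  refine antitoneOn_of_hasDerivWithinAt_nonpos (convex_Ici 0)
    (fun t ht => (hderiv t ht).continuousWithinAt)
    (fun t ht => (hderiv t (interior_subset ht)).mono interior_subset) fun t ht => ?_
  have := (sol.dissipation_bounds (w := fun _ => 0) hA1 hA2 hα₁ hβ₁ hγ₁ hμ₁ continuousOn_const
    (fun _ => ⟨le_rfl, zero_le_one⟩) (fun _ _ => rfl) (interior_subset ht)).1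
  linarith

lemma integral_sq_shifted_le_integral_weight (hw : ContinuousOn w (Icc 0 1))
    (hw0 : ∀ x, 0 ≤ w x) (hε₂ : 0 ≤ ε₂) (hε₂1 : ε₂ ≤ 1) (hw1 : ∀ x ≥ 1 - ε₂, w x = 1)
    (sol : ClassicalSolutionS a q α₁ α₂ β₁ γ₁ μ₁) {t : ℝ} (ht : t ∈ Ici (0:ℝ)) :
    (∫ x in (1 - ε₂)..1, sol.shifted t x ^ 2) ≤
      ∫ x in (0:ℝ)..1, w x * sol.shifted t x ^ 2 := by
  have hfc := slice_continuousOn sol.hasTimeDeriv_shifted.cont ht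
  have heq : (∫ x in (1 - ε₂)..1, sol.shifted t x ^ 2) =
      ∫ x in (1 - ε₂)..1, w x * sol.shifted t x ^ 2 := by
    refine intervalIntegral.integral_congr fun x hx => ?_
    rw [uIcc_of_le (by linarith)] at hx
    simp [hw1 x hx.1]
  rw [heq]
  exact intervalIntegral.integral_mono_interval (by linarith) (by linarith) le_rfl
    (Filter.Eventually.of_forall fun x => mul_nonneg (hw0 x) (sq_nonneg _))
    (intervalIntegrable_of_continuousOn_unit (hw.mul (hfc.pow 2)) (by simp) (by simp))

end ClassicalSolutionS

lemma exists_cutoff {b c : ℝ} (hbc : b < c) : ∃ w : ℝ → ℝ, Continuous w ∧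
    (∀ x, 0 ≤ w x ∧ w x ≤ 1) ∧ (∀ x ≤ b, w x = 0) ∧ ∀ x ≥ c, w x = 1 := by
  have h : 0 < c - b := sub_pos.2 hbc
  refine ⟨fun x => max 0 (min 1 ((x - b) / (c - b))), by fun_prop,
    fun x => ⟨le_max_left _ _, max_le zero_le_one (min_le_left _ _)⟩, fun x hx => ?_,
    fun x hx => ?_⟩
  · have : (x - b) / (c - b) ≤ 0 := div_nonpos_of_nonpos_of_nonneg (by linarith) h.le
    exact max_eq_left ((min_le_right _ _).trans this)
  · have : 1 ≤ (x - b) / (c - b) := (one_le_div h).2 (by linarith)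
    simp [min_eq_left this]

/-- Lemma 3.4: for every `δ > 0`, the localized `L²` norm of `u - u_*` in time is bounded by
`C δ ∫_S^T E + C (1/δ + 1) E(S)`. -/
theorem localized_estimate_S1 (a q : ℝ → ℝ)
    (a_min a_max ε₂ ε₃ q_min α₁ α₂ β₁ γ₁ μ₁ : ℝ)
    (hA1 : AssumptionA1 a a_min a_max) (hA2 : AssumptionA2' q ε₃ q_min)
    (hε₂ : 0 < ε₂) (hε₂₃ : ε₂ < ε₃)
    (hα₁ : 0 < α₁) (hα₂ : 0 < α₂) (hβ₁ : 0 < β₁) (hγ₁ : 0 < γ₁) (hμ₁ : 0 < μ₁) :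
    ∃ C > (0:ℝ), ∀ sol : ClassicalSolutionS a q α₁ α₂ β₁ γ₁ μ₁,
      ∀ S T : ℝ, 0 ≤ S → S ≤ T → ∀ δ : ℝ, 0 < δ →
        (∫ t in S..T, ∫ x in (1 - ε₂)..1, (sol.u t x - (sol.u 0 1 - sol.η₂ 0)) ^ 2)
          ≤ C * δ * (∫ t in S..T, energyS sol t) + C * (1 / δ + 1) * energyS sol S := by
  obtain ⟨w, hwc, hw01, hw0, hw1⟩ := exists_cutoff (show 1 - ε₃ < 1 - ε₂ by linarith)
  have h1 : (1:ℝ) ∈ Icc (0:ℝ) 1 := by simp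
  have ha : ∀ x ∈ Icc (0:ℝ) 1, 0 < a x := fun x hx => hA1.2.1.trans_le (hA1.2.2.2 x hx).1
  have ha1 := ha 1 h1
  have hac : ContinuousOn a (Icc 0 1) := by
    obtain ⟨⟨L, hL⟩, -⟩ := hA1
    exact hL.continuousOn
  have hε₃ : ε₃ < 1 := hA2.2.2.2.2.1
  have hqi := ClassicalSolutionS.intervalIntegrable_damping hA2
  obtain ⟨C, hC, hbd⟩ := ClassicalSolutionS.exists_multiplier_bounds hA1 hA2 hα₁ hα₂ hβ₁ hγ₁
    hμ₁ hwc.continuousOn hw01 hw0 (k := β₁ / (a 1 * α₂)) (by positivity)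
  refine ⟨3 * C, by positivity, fun sol S T hS hST δ hδ => ?_⟩
  set M := sol.multiplier w (β₁ / (a 1 * α₂))
  set N := fun t => ∫ x in (1 - ε₂)..1, sol.shifted t x ^ 2
  have hsub : Icc S T ⊆ Ici 0 := fun t ht => hS.trans ht.1
  have hE := fun t (ht : t ∈ Ici (0:ℝ)) =>
    sol.hasDerivWithinAt_energy hac hqi hβ₁.ne' hμ₁.ne' ht
  have hM := fun t (ht : t ∈ Ici (0:ℝ)) => sol.hasDerivWithinAt_multiplier
    (fun x hx => (ha x hx).ne') hac hwc.continuousOn hqi hα₂.ne' hβ₁.ne' hμ₁.ne' ht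
  have hEc : ContinuousOn (energyS sol) (Icc S T) := fun t ht =>
    ((hE t (hsub ht)).continuousWithinAt).mono hsub
  have hMc : ContinuousOn M (Icc S T) := fun t ht =>
    ((hM t (hsub ht)).continuousWithinAt).mono hsub
  have hNc : ContinuousOn N (Icc S T) := by
    have hder := sol.hasTimeDeriv_shifted.mul sol.hasTimeDeriv_shifted
    have hN : N = fun t => ∫ x in (1 - ε₂)..1, sol.shifted t x * sol.shifted t x := by
      simp only [N, sq]
    rw [hN]
    exact fun t ht => ((hder.hasDerivWithinAt_integral ⟨by linarith, by linarith⟩ h1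
      (hsub ht)).continuousWithinAt).mono hsub
  have hu : uIcc S T = Icc S T := uIcc_of_le hST
  have hmain := intervalIntegral.integral_le_sub_of_hasDeriv_right_of_le hST
    (g := fun t => M t - C * (1 / δ + 1) * energyS sol t)
    (φ := fun t => N t - C * δ * energyS sol t)
    (hMc.sub (continuousOn_const.mul hEc))
    (fun t ht => by
      have ht0 : t ∈ Ici (0:ℝ) := hsub (Ioo_subset_Icc_self ht)
      exact ((hM t ht0).sub ((hE t ht0).const_mul (C * (1 / δ + 1)))).mono
        fun s hs => ht0.trans (mem_Ioi.1 hs).le)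
    (hNc.sub (continuousOn_const.mul hEc)).integrableOn_Icc
    (fun t ht => by
      have ht0 : t ∈ Ici (0:ℝ) := hsub (Ioo_subset_Icc_self ht)
      have hN := sol.integral_sq_shifted_le_integral_weight hwc.continuousOn
        (fun x => (hw01 x).1) hε₂.le (by linarith) hw1 ht0
      have hR := (hbd sol t ht0).2 δ hδ
      simp only [N]
      linarith)
  rw [intervalIntegral.integral_sub (hu ▸ hNc).intervalIntegrable
    ((hu ▸ hEc).intervalIntegrable.const_mul _), intervalIntegral.integral_const_mul] at hmain
  have hT : T ∈ Ici (0:ℝ) := hS.trans hST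
  have heS := (sol.energy_bounds hA1 hα₂ hβ₁ hμ₁ hS).1
  have heT := (sol.energy_bounds hA1 hα₂ hβ₁ hμ₁ hT).1
  have hdec : energyS sol T ≤ energyS sol S :=
    sol.energy_antitoneOn hA1 hA2 hα₁ hβ₁ hγ₁ hμ₁ hS hT hST
  have hMS := (abs_le.1 (hbd sol S hS).1).1
  have hMT := (abs_le.1 (hbd sol T hT).1).2
  have hCT : C * energyS sol T ≤ C * energyS sol S := mul_le_mul_of_nonneg_left hdec hC.le
  have hI : 0 ≤ ∫ t in S..T, energyS sol t := intervalIntegral.integral_nonneg hST fun t ht =>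
    (sol.energy_bounds hA1 hα₂ hβ₁ hμ₁ (hsub ht)).1
  have r₁ : 0 ≤ C * δ * ∫ t in S..T, energyS sol t := by positivity
  have r₂ : 0 ≤ C * (1 / δ) * energyS sol S := by positivity
  have r₃ : 0 ≤ C * (1 / δ + 1) * energyS sol T := by positivity
  change ∫ t in S..T, N t ≤ _
  linarith
end

section
/- Let u : [0,1] → ℂ be C¹ with x ↦ a(x)u'(x) locally Lipschitz (so that (au')' exists a.e. and is essentially bounded), let v : [0,1] → ℂ be C¹, and let η₁, η₂, ζ₁ ∈ ℂ with v(1) = η₁ and v(0) = ζ₁. Then Re[ −∫₀¹ a(x) v'(x) conj(u'(x)) dx − ∫₀¹ ( (a u')'(x) − q(x)v(x) ) conj(v(x)) dx − c₁(−α₁η₁ − α₂η₂ − β₁u'(1)) conj(η₁) − c₂ η₁ conj(η₂) − c₃(−γ₁ζ₁ + μ₁u'(0)) conj(ζ₁) ] = ∫₀¹ q(x)|v(x)|² dx + c₁α₁|η₁|² + c₃γ₁|ζ₁|², where c₁ = a(1)/β₁, c₂ = a(1)α₂/β₁ and c₃ = a(0)/μ₁. -/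
open Set MeasureTheory

/-- The indefinite integral of an integrable function with values in a Banach space is absolutely
continuous. -/
theorem IntervalIntegrable.absolutelyContinuousOnInterval_integral {E : Type*}
    [NormedAddCommGroup E] [NormedSpace ℝ E] {f : ℝ → E} {a b c : ℝ}
    (h : IntervalIntegrable f volume a b) (hc : c ∈ uIcc a b) :
    AbsolutelyContinuousOnInterval (fun x => ∫ t in c..x, f t) a b := by
  have hnorm := h.norm.absolutelyContinuousOnInterval_intervalIntegral hc
  rw [absolutelyContinuousOnInterval_iff] at hnorm ⊢
  intro ε hε
  obtain ⟨δ, hδ, H⟩ := hnorm ε hε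
  refine ⟨δ, hδ, fun P hP hlt => (Finset.sum_le_sum fun i hi => ?_).trans_lt (H P hP hlt)⟩
  obtain ⟨hx, hy⟩ := hP.1 i hi
  have hi₁ : IntervalIntegrable f volume c (P.2 i).1 := h.mono_set (uIcc_subset_uIcc hc hx)
  have hi₂ : IntervalIntegrable f volume c (P.2 i).2 := h.mono_set (uIcc_subset_uIcc hc hy)
  rw [dist_eq_norm, dist_eq_norm, intervalIntegral.integral_interval_sub_left hi₁ hi₂,
    intervalIntegral.integral_interval_sub_left hi₁.norm hi₂.norm]
  exact intervalIntegral.norm_integral_le_abs_integral_norm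

/-- The *fundamental theorem of calculus* for an absolutely continuous function with values in a
Banach space whose derivative exists almost everywhere and is integrable. -/
theorem AbsolutelyContinuousOnInterval.integral_eq_sub_of_ae_hasDerivAt {E : Type*}
    [NormedAddCommGroup E] [NormedSpace ℝ E] [CompleteSpace E] {f f' : ℝ → E} {a b : ℝ}
    (hf : AbsolutelyContinuousOnInterval f a b)
    (hderiv : ∀ᵐ x, x ∈ uIcc a b → HasDerivAt f (f' x) x)
    (hint : IntervalIntegrable f' volume a b) :
    ∫ x in a..b, f' x = f b - f a := by
  have hac : AbsolutelyContinuousOnInterval (fun x => f x - ∫ t in a..x, f' t) a b :=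
    hf.fun_sub (hint.absolutelyContinuousOnInterval_integral (c := a) (by simp))
  obtain ⟨C, hC⟩ := hac.const_of_ae_hasDerivAt_zero (by
    filter_upwards [hderiv, hint.ae_hasDerivAt_integral] with x hx₁ hx₂ hx₃
    simpa using (hx₁ hx₃).fun_sub (hx₂ hx₃ a (by simp)))
  have ha := hC a (by simp)
  have hb := hC b (by simp)
  simp only [intervalIntegral.integral_same, sub_zero] at ha
  rw [ha, ← hb]
  abel

open scoped ComplexConjugate in
/-- Integration by parts on `[0,1]` for a Lipschitz function `g` against the conjugate of a `C¹`
function `v`. -/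
theorem integral_mul_conj_eq_sub_of_lipschitzOnWith {g w v v' : ℝ → ℂ} {K : NNReal}
    (hg : LipschitzOnWith K g (uIcc 0 1))
    (hw : ∀ᵐ x, x ∈ uIcc (0 : ℝ) 1 → HasDerivAt g (w x) x)
    (hwi : IntervalIntegrable w volume 0 1)
    (hv : ∀ x ∈ uIcc (0 : ℝ) 1, HasDerivAt v (v' x) x) (hv' : ContinuousOn v' (uIcc 0 1)) :
    ∫ x in (0 : ℝ)..1, w x * conj (v x) =
      g 1 * conj (v 1) - g 0 * conj (v 0) - ∫ x in (0 : ℝ)..1, g x * conj (v' x) := by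
  have hvc : ContinuousOn v (uIcc 0 1) := fun x hx => (hv x hx).continuousAt.continuousWithinAt
  have hcv : ContinuousOn (fun x => conj (v x)) (uIcc 0 1) :=
    Complex.continuous_conj.comp_continuousOn hvc
  have hcv' : ContinuousOn (fun x => conj (v' x)) (uIcc 0 1) :=
    Complex.continuous_conj.comp_continuousOn hv'
  have hcd : ∀ x ∈ uIcc (0 : ℝ) 1, HasDerivAt (fun x => conj (v x)) (conj (v' x)) x :=
    fun x hx => (hv x hx).star
  obtain ⟨C, hC⟩ := isCompact_uIcc.exists_bound_of_continuousOn hcv'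
  have hvl : LipschitzOnWith C.toNNReal (fun x => conj (v x)) (uIcc 0 1) := by
    refine (convex_uIcc 0 1).lipschitzOnWith_of_nnnorm_hasDerivWithin_le
      (fun x hx => (hcd x hx).hasDerivWithinAt) fun x hx => ?_
    exact NNReal.coe_le_coe.1 ((hC x hx).trans (Real.le_coe_toNNReal C))
  have h1 : IntervalIntegrable (fun x => w x * conj (v x)) volume 0 1 := hwi.mul_continuousOn hcv
  have h2 : IntervalIntegrable (fun x => g x * conj (v' x)) volume 0 1 :=
    (hg.continuousOn.mul hcv').intervalIntegrable
  have key := (hg.absolutelyContinuousOnInterval.fun_smul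
    hvl.absolutelyContinuousOnInterval).integral_eq_sub_of_ae_hasDerivAt
    (f' := fun x => w x * conj (v x) + g x * conj (v' x))
    (by filter_upwards [hw] with x hx hxm using (hx hxm).mul (hcd x hxm)) (h1.add h2)
  rw [intervalIntegral.integral_add h1 h2] at key
  simp only [smul_eq_mul] at key
  linear_combination key

/-- The dissipation identity `Re⟨-𝒜U, U⟩ = ∫₀¹ q|v|² + c₁α₁|η₁|² + c₃γ₁|ζ₁|²` for the wave
operator with Wentzell boundary conditions, where `c₁ = a(1)/β₁`, `c₂ = a(1)α₂/β₁`,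
`c₃ = a(0)/μ₁`. -/
theorem dissipation_identity (a q : ℝ → ℝ) (a_min a_max α₁ α₂ β₁ γ₁ μ₁ : ℝ)
    (hA1 : AssumptionA1 a a_min a_max)
    (hq_meas : Measurable q) (hq_bdd : ∃ Q : ℝ, ∀ x ∈ Icc (0:ℝ) 1, |q x| ≤ Q)
    (hq_nonneg : ∀ᵐ x ∂(volume.restrict (Ioo (0:ℝ) 1)), 0 ≤ q x)
    (hα₁ : 0 < α₁) (hα₂ : 0 < α₂) (hβ₁ : 0 < β₁) (hγ₁ : 0 < γ₁) (hμ₁ : 0 < μ₁)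
    (u u' v v' w : ℝ → ℂ) (η₁ η₂ ζ₁ : ℂ)
    (hu : ∀ x ∈ Icc (0:ℝ) 1, HasDerivAt u (u' x) x) (hu' : ContinuousOn u' (Icc (0:ℝ) 1))
    (hlip : ∃ K : NNReal, LipschitzOnWith K (fun x => (a x : ℂ) * u' x) (Icc (0:ℝ) 1))
    (hw : ∀ᵐ x ∂(volume.restrict (Ioo (0:ℝ) 1)),
      HasDerivAt (fun y => (a y : ℂ) * u' y) (w x) x)
    (hw_bdd : ∃ Q : ℝ, ∀ᵐ x ∂(volume.restrict (Ioo (0:ℝ) 1)), ‖w x‖ ≤ Q)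
    (hv : ∀ x ∈ Icc (0:ℝ) 1, HasDerivAt v (v' x) x) (hv' : ContinuousOn v' (Icc (0:ℝ) 1))
    (hv1 : v 1 = η₁) (hv0 : v 0 = ζ₁) :
    (-(∫ x in (0:ℝ)..1, (a x : ℂ) * v' x * (starRingEnd ℂ) (u' x))
      - (∫ x in (0:ℝ)..1, (w x - (q x : ℂ) * v x) * (starRingEnd ℂ) (v x))
      - ((a 1 / β₁ : ℝ) : ℂ) * (-(α₁ : ℂ) * η₁ - (α₂ : ℂ) * η₂ - (β₁ : ℂ) * u' 1)
          * (starRingEnd ℂ) η₁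
      - ((a 1 * α₂ / β₁ : ℝ) : ℂ) * η₁ * (starRingEnd ℂ) η₂
      - ((a 0 / μ₁ : ℝ) : ℂ) * (-(γ₁ : ℂ) * ζ₁ + (μ₁ : ℂ) * u' 0)
          * (starRingEnd ℂ) ζ₁).re
    = (∫ x in (0:ℝ)..1, q x * ‖v x‖ ^ 2)
      + (a 1 / β₁) * α₁ * ‖η₁‖ ^ 2 + (a 0 / μ₁) * γ₁ * ‖ζ₁‖ ^ 2 := by
  obtain ⟨K, hK⟩ := hlip
  obtain ⟨Q, hQ⟩ := hq_bdd
  obtain ⟨W, hW⟩ := hw_bdd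
  obtain ⟨⟨L, hL⟩, -⟩ := hA1
  have hI : uIcc (0 : ℝ) 1 = Icc 0 1 := uIcc_of_le zero_le_one
  have hae : volume.restrict (Ioo (0 : ℝ) 1) = volume.restrict (Icc 0 1) :=
    Measure.restrict_congr_set Ioo_ae_eq_Icc
  have hae' : volume.restrict (Ioo (0 : ℝ) 1) = volume.restrict (Ioc 0 1) :=
    Measure.restrict_congr_set Ioo_ae_eq_Ioc
  have hwi : IntervalIntegrable w volume 0 1 := by
    rw [intervalIntegrable_iff_integrableOn_Ioc_of_le zero_le_one, IntegrableOn, ← hae']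
    refine Integrable.of_bound ((aestronglyMeasurable_deriv
      (fun x => (a x : ℂ) * u' x) _).congr ?_) W hW
    filter_upwards [hw] with x hx using hx.deriv
  have hqi : IntervalIntegrable q volume 0 1 := by
    rw [intervalIntegrable_iff_integrableOn_Icc_of_le zero_le_one]
    refine Integrable.of_bound hq_meas.aestronglyMeasurable Q ?_
    exact (ae_restrict_iff' measurableSet_Icc).2 (.of_forall hQ)
  have hvc : ContinuousOn v (uIcc 0 1) := fun x hx =>
    (hv x (hI ▸ hx)).continuousAt.continuousWithinAt
  have hcv : ContinuousOn (fun x => (starRingEnd ℂ) (v x)) (uIcc 0 1) :=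
    Complex.continuous_conj.comp_continuousOn hvc
  have hac : ContinuousOn (fun x => (a x : ℂ)) (uIcc 0 1) :=
    Complex.continuous_ofReal.comp_continuousOn (hI ▸ hL.continuousOn)
  have hparts := integral_mul_conj_eq_sub_of_lipschitzOnWith (hI ▸ hK)
    (by rw [hI]; exact (ae_restrict_iff' measurableSet_Icc).1 (hae ▸ hw)) hwi
    (hI ▸ hv) (hI ▸ hv')
  have hqv : IntervalIntegrable (fun x => (q x : ℂ) * v x * (starRingEnd ℂ) (v x)) volume 0 1 :=
    (IntervalIntegrable.mul_continuousOn ⟨hqi.1.ofReal, hqi.2.ofReal⟩ hvc).mul_continuousOn hcv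
  have hsplit : ∫ x in (0 : ℝ)..1, (w x - (q x : ℂ) * v x) * (starRingEnd ℂ) (v x) =
      (∫ x in (0 : ℝ)..1, w x * (starRingEnd ℂ) (v x)) -
        ((∫ x in (0 : ℝ)..1, q x * ‖v x‖ ^ 2 : ℝ) : ℂ) := by
    simp only [sub_mul]
    rw [intervalIntegral.integral_sub (hwi.mul_continuousOn hcv) hqv,
      ← intervalIntegral.integral_ofReal]
    congr 2
    ext x
    rw [mul_assoc, Complex.mul_conj']
    push_cast
    rfl
  have hconj : ∫ x in (0 : ℝ)..1, (a x : ℂ) * v' x * (starRingEnd ℂ) (u' x) =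
      (starRingEnd ℂ) (∫ x in (0 : ℝ)..1, (a x : ℂ) * u' x * (starRingEnd ℂ) (v' x)) := by
    rw [intervalIntegral.integral_of_le zero_le_one, intervalIntegral.integral_of_le zero_le_one,
      ← integral_conj]
    congr 1
    ext x
    simp only [map_mul, Complex.conj_ofReal, Complex.conj_conj]
    ring
  rw [hsplit, hparts, hconj, hv1, hv0]
  have hβ : a 1 / β₁ * β₁ = a 1 := div_mul_cancel₀ _ hβ₁.ne'
  have hμ : a 0 / μ₁ * μ₁ = a 0 := div_mul_cancel₀ _ hμ₁.ne'
  rw [mul_div_right_comm, ← Complex.normSq_eq_norm_sq, ← Complex.normSq_eq_norm_sq]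
  generalize a 1 / β₁ = c₁ at *
  generalize a 0 / μ₁ = c₃ at *
  rw [← hβ, ← hμ]
  simp only [Complex.sub_re, Complex.neg_re, Complex.add_re, Complex.mul_re, Complex.mul_im,
    Complex.sub_im, Complex.neg_im, Complex.add_im, Complex.conj_re, Complex.conj_im,
    Complex.ofReal_re, Complex.ofReal_im, Complex.normSq_apply]
  ring
end
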